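/- Let p>2, let u be a nonnegative classical solution of u_t−Δu=|∇u|^p in Q_T with u=0 on Γ_T, having an isolated gradient blowup point at (0,0,T) and satisfying the monotonicity condition x·u_x≤0 in Q_T. Then u_y(x,y,t) → +∞ as (x,y)→(0,0) and t→T⁻; that is, for every M>0 there exists δ>0 such that u_y(x,y,t) ≥ M whenever (x,y,t)∈Q_T, |x|+|y|<δ and T−δ<t<T. -/

import Mathlib

open Real Set Filter MeasureTheory

noncomputable section

/-- Partial derivative of `u(x,y,t)` with respect to `x`. -/
def pdx (u : ℝ → ℝ → ℝ → ℝ) (x y t : ℝ) : ℝ := deriv (fun s => u s y t) x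

/-- Partial derivative with respect to `y`. -/
def pdy (u : ℝ → ℝ → ℝ → ℝ) (x y t : ℝ) : ℝ := deriv (fun s => u x s t) y

/-- Partial derivative with respect to `t`. -/
def pdt (u : ℝ → ℝ → ℝ → ℝ) (x y t : ℝ) : ℝ := deriv (fun s => u x y s) t

/-- Second partial derivative with respect to `x`. -/
def pdxx (u : ℝ → ℝ → ℝ → ℝ) (x y t : ℝ) : ℝ := deriv (fun s => pdx u s y t) x

/-- Second partial derivative with respect to `y`. -/
def pdyy (u : ℝ → ℝ → ℝ → ℝ) (x y t : ℝ) : ℝ := deriv (fun s => pdy u x s t) y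

/-- Mixed second partial derivative `u_{xy}` (first `x`, then `y`). -/
def pdxy (u : ℝ → ℝ → ℝ → ℝ) (x y t : ℝ) : ℝ := deriv (fun s => pdx u x s t) y

/-- The norm of the spatial gradient, `|∇u| = (u_x² + u_y²)^{1/2}`. -/
def gradNorm (u : ℝ → ℝ → ℝ → ℝ) (x y t : ℝ) : ℝ :=
  Real.sqrt ((pdx u x y t) ^ 2 + (pdy u x y t) ^ 2)

/-- `C^{2,1}`-type regularity of `u` at the point `(x,y,t)`: twice (continuously)
differentiable in the space variables and once in time. -/
def C21At (u : ℝ → ℝ → ℝ → ℝ) (x y t : ℝ) : Prop :=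
  DifferentiableAt ℝ (fun s => u s y t) x ∧
  DifferentiableAt ℝ (fun s => u x s t) y ∧
  DifferentiableAt ℝ (fun s => u x y s) t ∧
  DifferentiableAt ℝ (fun s => pdx u s y t) x ∧
  DifferentiableAt ℝ (fun s => pdy u x s t) y ∧
  DifferentiableAt ℝ (fun s => pdx u x s t) y ∧
  ContinuousAt (fun q : ℝ × ℝ × ℝ => u q.1 q.2.1 q.2.2) (x, y, t) ∧
  ContinuousAt (fun q : ℝ × ℝ × ℝ => pdx u q.1 q.2.1 q.2.2) (x, y, t) ∧
  ContinuousAt (fun q : ℝ × ℝ × ℝ => pdy u q.1 q.2.1 q.2.2) (x, y, t) ∧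
  ContinuousAt (fun q : ℝ × ℝ × ℝ => pdt u q.1 q.2.1 q.2.2) (x, y, t) ∧
  ContinuousAt (fun q : ℝ × ℝ × ℝ => pdxx u q.1 q.2.1 q.2.2) (x, y, t) ∧
  ContinuousAt (fun q : ℝ × ℝ × ℝ => pdyy u q.1 q.2.1 q.2.2) (x, y, t) ∧
  ContinuousAt (fun q : ℝ × ℝ × ℝ => pdxy u q.1 q.2.1 q.2.2) (x, y, t)

/-- `u` is a nonnegative classical solution of `u_t - Δu = |∇u|^p` in
`Q_T = ω × (0,T)`, `ω = (-L,L) × (0,L)`, with `u = 0` on `Γ_T = (-L,L) × {0} × (0,T)`. -/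
structure ClassicalSolution (p L T : ℝ) (u : ℝ → ℝ → ℝ → ℝ) : Prop where
  nonneg : ∀ ⦃x y t : ℝ⦄, |x| ≤ L → y ∈ Icc (0:ℝ) L → t ∈ Ioo 0 T → 0 ≤ u x y t
  smooth : ∀ ⦃x y t : ℝ⦄, |x| ≤ L → y ∈ Icc (0:ℝ) L → t ∈ Ioo 0 T → C21At u x y t
  pde : ∀ ⦃x y t : ℝ⦄, |x| < L → y ∈ Ioo (0:ℝ) L → t ∈ Ioo 0 T →
    pdt u x y t - (pdxx u x y t + pdyy u x y t) = gradNorm u x y t ^ p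
  bc : ∀ ⦃x t : ℝ⦄, |x| < L → t ∈ Ioo 0 T → u x 0 t = 0

/-- `u` has an isolated gradient blow-up point at `(0,0,T)`:
`limsup |∇u| = ∞` at `(0,0,T)` while `∇u` stays bounded on `K × (0,T)` for every
compact `K ⊆ ω̄ \ {(0,0)}`. -/
structure IsolatedGBU (L T : ℝ) (u : ℝ → ℝ → ℝ → ℝ) : Prop where
  blowup : ∀ M : ℝ, ∀ δ > (0:ℝ), ∃ x y t : ℝ, |x| ≤ L ∧ y ∈ Icc (0:ℝ) L ∧
    t ∈ Ioo 0 T ∧ |x| < δ ∧ |y| < δ ∧ T - δ < t ∧ M < gradNorm u x y t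
  bounded : ∀ K : Set (ℝ × ℝ), IsCompact K →
    K ⊆ (Icc (-L) L ×ˢ Icc (0:ℝ) L) \ {((0:ℝ), (0:ℝ))} →
    ∃ M : ℝ, ∀ q ∈ K, ∀ t ∈ Ioo (0:ℝ) T, gradNorm u q.1 q.2 t ≤ M

/-- `u` extends as a `C^{2,1}` function to `(ω̄' × [T/2,T]) \ {(0,0,T)}`,
`ω' = (-L/2,L/2) × (0,L/2)`; values and derivatives at `t = T` refer to this extension. -/
def ExtC21 (L T : ℝ) (u : ℝ → ℝ → ℝ → ℝ) : Prop :=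
  ∀ ⦃x y t : ℝ⦄, |x| ≤ L / 2 → y ∈ Icc (0:ℝ) (L / 2) → t ∈ Icc (T / 2) T →
    ¬(x = 0 ∧ y = 0 ∧ t = T) → C21At u x y t

/-- The monotonicity condition `x·u_x ≤ 0` in `Q_T`. -/
def MonCond (L T : ℝ) (u : ℝ → ℝ → ℝ → ℝ) : Prop :=
  ∀ ⦃x y t : ℝ⦄, |x| < L → y ∈ Ioo (0:ℝ) L → t ∈ Ioo 0 T → x * pdx u x y t ≤ 0


/-- one-dimensional second order jets -/
def J2 (f : ℝ → ℝ) (x b c : ℝ) : Prop :=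
  ∃ f' : ℝ → ℝ, (∀ᶠ s in nhds x, HasDerivAt f (f' s) s) ∧ f' x = b ∧ HasDerivAt f' c x

lemma J2.hasDerivAt {f : ℝ → ℝ} {x b c : ℝ} (h : J2 f x b c) : HasDerivAt f b x := by
  obtain ⟨f', h1, h2, h3⟩ := h
  rw [← h2]; exact h1.self_of_nhds

lemma J2.add {f g : ℝ → ℝ} {x b c b' c' : ℝ} (hf : J2 f x b c) (hg : J2 g x b' c') :
    J2 (fun s => f s + g s) x (b + b') (c + c') := by
  obtain ⟨f', h1, h2, h3⟩ := hf
  obtain ⟨g', k1, k2, k3⟩ := hg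
  refine ⟨fun s => f' s + g' s, ?_, by simp [h2, k2], h3.add k3⟩
  filter_upwards [h1, k1] with s a b using a.add b

lemma J2.mul {f g : ℝ → ℝ} {x b c b' c' : ℝ} (hf : J2 f x b c) (hg : J2 g x b' c') :
    J2 (fun s => f s * g s) x (b * g x + f x * b') (c * g x + 2 * b * b' + f x * c') := by
  have hfd := hf.hasDerivAt
  have hgd := hg.hasDerivAt
  obtain ⟨f', h1, h2, h3⟩ := hf
  obtain ⟨g', k1, k2, k3⟩ := hg
  refine ⟨fun s => f' s * g s + f s * g' s, ?_, by simp [h2, k2], ?_⟩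
  · filter_upwards [h1, k1] with s a b using a.mul b
  · exact ((h3.mul hgd).add (hfd.mul k3)).congr_deriv (by rw [h2, k2]; ring)

lemma J2.const (k x : ℝ) : J2 (fun _ => k) x 0 0 :=
  ⟨fun _ => 0, Eventually.of_forall fun s => hasDerivAt_const s k, rfl, hasDerivAt_const x 0⟩

lemma J2.cmul {f : ℝ → ℝ} {x b c : ℝ} (k : ℝ) (hf : J2 f x b c) :
    J2 (fun s => k * f s) x (k * b) (k * c) := by
  have := (J2.const k x).mul hf
  simpa using this

lemma J2.shift {f : ℝ → ℝ} {x b c : ℝ} (k : ℝ) (hf : J2 f (x + k) b c) :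
    J2 (fun s => f (s + k)) x b c := by
  obtain ⟨f', h1, h2, h3⟩ := hf
  refine ⟨fun s => f' (s + k), ?_, h2, ?_⟩
  · have ht : Tendsto (fun s : ℝ => s + k) (nhds x) (nhds (x + k)) :=
      (continuous_id.add continuous_const).tendsto x
    filter_upwards [ht.eventually h1] with s hs
    exact hs.comp_add_const s k
  · exact h3.comp_add_const x k

lemma J2.max {f : ℝ → ℝ} {x b c : ℝ} (hf : J2 f x b c) (hm : IsLocalMax f x) : b = 0 ∧ c ≤ 0 := by
  have hb : b = 0 := hm.hasDerivAt_eq_zero hf.hasDerivAt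
  refine ⟨hb, ?_⟩
  by_contra hc
  push Not at hc
  have hfd := hf.hasDerivAt
  obtain ⟨f', h1, h2, h3⟩ := hf
  have e1 : deriv f =ᶠ[nhds x] f' := by
    filter_upwards [h1] with s hs using hs.deriv
  have e2 : deriv (deriv f) x = c := by
    rw [e1.deriv_eq]; exact h3.deriv
  have hmin := isLocalMin_of_deriv_deriv_pos (f := f) (x₀ := x) (by rw [e2]; exact hc)
    (by rw [hfd.deriv, hb]) hfd.continuousAt
  have e3 : f =ᶠ[nhds x] fun _ => f x := by
    filter_upwards [hm, hmin] with s a b using le_antisymm a b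
  have e4 : deriv f =ᶠ[nhds x] fun _ => 0 := by
    have := e3.deriv
    filter_upwards [this] with s hs
    rw [hs]; simp
  have : deriv (deriv f) x = 0 := by rw [e4.deriv_eq]; simp
  linarith

lemma time_max {f : ℝ → ℝ} {t t0 b : ℝ} (h0 : t0 < t) (hf : HasDerivAt f b t)
    (hm : ∀ᶠ s in nhds t, t0 ≤ s → s ≤ t → f s ≤ f t) : 0 ≤ b := by
  have h1 := hf.tendsto_slope
  have h2 : Tendsto (slope f t) (nhdsWithin t (Iio t)) (nhds b) :=
    h1.mono_left (nhdsWithin_mono _ (fun s hs => ne_of_lt hs))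
  refine ge_of_tendsto h2 ?_
  have h3 : ∀ᶠ s in nhds t, t0 < s := lt_mem_nhds h0
  filter_upwards [self_mem_nhdsWithin, nhdsWithin_le_nhds hm, nhdsWithin_le_nhds h3] with s a b c
  have a' : s < t := a
  rw [slope_def_field]
  exact div_nonneg_of_nonpos (by linarith [b c.le a'.le]) (by linarith)

/-- pointwise differential inequality -/
def Spr (w : ℝ → ℝ → ℝ → ℝ) (B x y t : ℝ) : Prop :=
  ∃ wx wy wxx wyy wt, J2 (fun s => w s y t) x wx wxx ∧ J2 (fun s => w x s t) y wy wyy ∧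
    HasDerivAt (fun s => w x y s) wt t ∧ -(B * (|wx| + |wy|)) ≤ wt - wxx - wyy

def Cyl (a b t0 t1 : ℝ) : Set (ℝ × ℝ × ℝ) :=
  {q | a ≤ q.1 ^ 2 + q.2.1 ^ 2 ∧ q.1 ^ 2 + q.2.1 ^ 2 ≤ b ∧ 0 ≤ q.2.1 ∧ t0 ≤ q.2.2 ∧ q.2.2 ≤ t1}

lemma cyl_compact (a b t0 t1 : ℝ) : IsCompact (Cyl a b t0 t1) := by
  have hc : IsClosed (Cyl a b t0 t1) := by
    have e : Cyl a b t0 t1 = {q : ℝ × ℝ × ℝ | a ≤ q.1 ^ 2 + q.2.1 ^ 2} ∩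
        ({q : ℝ × ℝ × ℝ | q.1 ^ 2 + q.2.1 ^ 2 ≤ b} ∩ ({q : ℝ × ℝ × ℝ | 0 ≤ q.2.1} ∩
        ({q : ℝ × ℝ × ℝ | t0 ≤ q.2.2} ∩ {q : ℝ × ℝ × ℝ | q.2.2 ≤ t1}))) := by
      ext q; simp [Cyl]
    rw [e]
    refine IsClosed.inter (isClosed_le (by fun_prop) (by fun_prop)) ?_
    refine IsClosed.inter (isClosed_le (by fun_prop) (by fun_prop)) ?_
    refine IsClosed.inter (isClosed_le (by fun_prop) (by fun_prop)) ?_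
    exact IsClosed.inter (isClosed_le (by fun_prop) (by fun_prop))
      (isClosed_le (by fun_prop) (by fun_prop))
  have hb : IsCompact ((Icc (-(|b| + 1)) (|b| + 1)) ×ˢ ((Icc (-(|b| + 1)) (|b| + 1)) ×ˢ Icc t0 t1)) :=
    isCompact_Icc.prod (isCompact_Icc.prod isCompact_Icc)
  refine hb.of_isClosed_subset hc ?_
  rintro ⟨x, y, t⟩ ⟨h1, h2, h3, h4, h5⟩
  simp only at h1 h2 h3 h4 h5
  have hb := le_abs_self b
  have hb0 := abs_nonneg b
  refine ⟨⟨?_, ?_⟩, ⟨?_, ?_⟩, h4, h5⟩ <;> simp only <;> nlinarith [sq_nonneg x, sq_nonneg y, sq_nonneg |b|]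

/-- eventually inside -/
lemma ev_x {a b x y : ℝ} (h1 : a < x ^ 2 + y ^ 2) (h2 : x ^ 2 + y ^ 2 < b) :
    ∀ᶠ s in nhds x, a < s ^ 2 + y ^ 2 ∧ s ^ 2 + y ^ 2 < b := by
  have hc : ContinuousAt (fun s : ℝ => s ^ 2 + y ^ 2) x := by fun_prop
  exact (hc.eventually (lt_mem_nhds h1)).and (hc.eventually (gt_mem_nhds h2))

lemma ev_y {a b x y : ℝ} (h1 : a < x ^ 2 + y ^ 2) (h2 : x ^ 2 + y ^ 2 < b) (h3 : 0 < y) :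
    ∀ᶠ s in nhds y, a < x ^ 2 + s ^ 2 ∧ x ^ 2 + s ^ 2 < b ∧ 0 < s := by
  have hc : ContinuousAt (fun s : ℝ => x ^ 2 + s ^ 2) y := by fun_prop
  filter_upwards [hc.eventually (lt_mem_nhds h1), hc.eventually (gt_mem_nhds h2), lt_mem_nhds h3]
    with s a b c using ⟨a, b, c⟩

/-- minimum principle on the half disc -/
lemma min_disc (r t0 t1 B C : ℝ) (w : ℝ → ℝ → ℝ → ℝ)
    (hc : ContinuousOn (fun q : ℝ × ℝ × ℝ => w q.1 q.2.1 q.2.2) (Cyl (-1) r t0 t1))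
    (hs : ∀ x y t, x ^ 2 + y ^ 2 < r → 0 < y → t0 < t → t ≤ t1 → Spr w B x y t)
    (hi : ∀ x y, x ^ 2 + y ^ 2 ≤ r → 0 ≤ y → t0 ≤ t1 → -C ≤ w x y t0)
    (hr : ∀ x y t, x ^ 2 + y ^ 2 = r → 0 ≤ y → t0 ≤ t → t ≤ t1 → -C ≤ w x y t)
    (hb : ∀ x t, x ^ 2 ≤ r → t0 ≤ t → t ≤ t1 → -C ≤ w x 0 t) :
    ∀ x y t, x ^ 2 + y ^ 2 ≤ r → 0 ≤ y → t0 ≤ t → t ≤ t1 → -C ≤ w x y t := by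
  intro x y t h1 h2 h3 h4
  have key : ∀ ε > 0, -C - ε * (t1 - t0) ≤ w x y t := by
    intro ε hε
    have hc' : ContinuousOn (fun q : ℝ × ℝ × ℝ => w q.1 q.2.1 q.2.2 + ε * (q.2.2 - t0))
        (Cyl (-1) r t0 t1) := hc.add (by fun_prop)
    have hmem : (x, y, t) ∈ Cyl (-1) r t0 t1 := ⟨by simp only; nlinarith [sq_nonneg x, sq_nonneg y], h1, h2, h3, h4⟩
    obtain ⟨⟨X, Y, S⟩, hq, hmin⟩ := (cyl_compact (-1) r t0 t1).exists_isMinOn ⟨_, hmem⟩ hc'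
    have hmin' : ∀ a b c, a ^ 2 + b ^ 2 ≤ r → 0 ≤ b → t0 ≤ c → c ≤ t1 →
        w X Y S + ε * (S - t0) ≤ w a b c + ε * (c - t0) := fun a b c k1 k2 k3 k4 =>
      hmin (show (a, b, c) ∈ Cyl (-1) r t0 t1 from ⟨by simp only; nlinarith [sq_nonneg a, sq_nonneg b], k1, k2, k3, k4⟩)
    obtain ⟨-, q2, q3, q4, q5⟩ := hq
    simp only at q2 q3 q4 q5
    have goal : -C ≤ w X Y S := by
      rcases q3.eq_or_lt with e | q3
      · rw [← e] at q2 ⊢; exact hb X S (by nlinarith) q4 q5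
      rcases q4.eq_or_lt with e | q4
      · rw [← e]; exact hi X Y q2 q3.le (by linarith)
      rcases q2.eq_or_lt with e | q2
      · exact hr X Y S e q3.le q4.le q5
      exfalso
      obtain ⟨wx, wy, wxx, wyy, wt, jx, jy, jt, hin⟩ := hs X Y S q2 q3 q4 q5
      have hq1 : -1 < X ^ 2 + Y ^ 2 := by nlinarith [sq_nonneg X, sq_nonneg Y]
      have mx := (jx.cmul (-1)).max (by
        filter_upwards [ev_x hq1 q2] with s hs
        have := hmin' s Y S hs.2.le q3.le q4.le q5
        linarith)
      have my := (jy.cmul (-1)).max (by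
        filter_upwards [ev_y hq1 q2 q3] with s hs
        have := hmin' X s S hs.2.1.le hs.2.2.le q4.le q5
        linarith)
      have mt := time_max (f := fun s => -(w X Y s) - ε * (s - t0)) (t := S) (b := -wt - ε * 1) q4
        (jt.neg.sub (((hasDerivAt_id S).sub_const t0).const_mul ε)) (by
          refine Eventually.of_forall fun s k1 k2 => ?_
          have := hmin' X Y s q2.le q3.le k1 (by linarith)
          linarith)
      have e1 : wx = 0 := by linarith [mx.1]
      have e2 : wy = 0 := by linarith [my.1]
      rw [e1, e2] at hin
      simp at hin
      linarith [mx.2, my.2]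
    have := hmin' x y t h1 h2 h3 h4
    nlinarith
  by_contra hcon
  push Not at hcon
  have hd : 0 ≤ t1 - t0 := by linarith
  have := key ((-C - w x y t) / (2 * (t1 - t0 + 1))) (by apply div_pos <;> linarith)
  have h5 : (-C - w x y t) / (2 * (t1 - t0 + 1)) * (t1 - t0) ≤ (-C - w x y t) / 2 := by
    rw [div_mul_eq_mul_div, div_le_div_iff₀ (by linarith) (by norm_num)]
    nlinarith
  linarith


def cut (R x y : ℝ) : ℝ := (x ^ 2 + y ^ 2 - R ^ 2 / 4) * (4 * R ^ 2 - (x ^ 2 + y ^ 2))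
def cut1 (R x y : ℝ) : ℝ := 2 * x * (4 * R ^ 2 + R ^ 2 / 4 - 2 * (x ^ 2 + y ^ 2))
def cut2 (R x y : ℝ) : ℝ := 2 * (4 * R ^ 2 + R ^ 2 / 4 - 2 * (x ^ 2 + y ^ 2)) - 8 * x ^ 2

lemma cut_symm (R x y : ℝ) : cut R x y = cut R y x := by unfold cut; ring

lemma cut_j (R x y : ℝ) : J2 (fun s => cut R s y) x (cut1 R x y) (cut2 R x y) := by
  refine ⟨fun s => cut1 R s y, Eventually.of_forall fun s => ?_, rfl, ?_⟩
  · have h : HasDerivAt (fun s : ℝ => s ^ 2 + y ^ 2) (2 * s) s := by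
      simpa using (hasDerivAt_pow 2 s).add_const (y ^ 2)
    exact ((h.sub_const (R ^ 2 / 4)).mul (h.const_sub (4 * R ^ 2))).congr_deriv (by
      unfold cut1; ring)
  · have h : HasDerivAt (fun s : ℝ => s ^ 2 + y ^ 2) (2 * x) x := by
      simpa using (hasDerivAt_pow 2 x).add_const (y ^ 2)
    exact (((hasDerivAt_id x).const_mul 2).mul ((h.const_mul 2).const_sub (4 * R ^ 2 + R ^ 2 / 4))).congr_deriv (by
      unfold cut2; simp; ring)

lemma cut_bound (R B : ℝ) : ∃ C : ℝ, 0 < C ∧ ∀ x y : ℝ, x ^ 2 + y ^ 2 ≤ 4 * R ^ 2 →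
    (cut R x y) ^ 2 ≤ C ∧
    2 * (cut R x y) ^ 2 * B ^ 2 + 16 * ((cut1 R x y) ^ 2 + (cut1 R y x) ^ 2)
      + 2 * |cut R x y * (cut2 R x y + cut2 R y x)| ≤ C := by
  have hK : IsCompact ((Icc (-(2 * |R|)) (2 * |R|)) ×ˢ (Icc (-(2 * |R|)) (2 * |R|))) :=
    isCompact_Icc.prod isCompact_Icc
  obtain ⟨C, hC⟩ := hK.exists_bound_of_continuousOn
    (f := fun q : ℝ × ℝ => (cut R q.1 q.2) ^ 2 + (2 * (cut R q.1 q.2) ^ 2 * B ^ 2 +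
      16 * ((cut1 R q.1 q.2) ^ 2 + (cut1 R q.2 q.1) ^ 2)
      + 2 * |cut R q.1 q.2 * (cut2 R q.1 q.2 + cut2 R q.2 q.1)|)) (by
        unfold cut cut1 cut2
        exact Continuous.continuousOn (by fun_prop))
  refine ⟨|C| + 1, by positivity, fun x y h => ?_⟩
  have hx : |x| ≤ 2 * |R| := by
    apply abs_le_of_sq_le_sq _ (by positivity)
    rw [mul_pow, sq_abs]; nlinarith [sq_nonneg y]
  have hy : |y| ≤ 2 * |R| := by
    apply abs_le_of_sq_le_sq _ (by positivity)
    rw [mul_pow, sq_abs]; nlinarith [sq_nonneg x]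
  have := hC (x, y) ⟨abs_le.1 hx, abs_le.1 hy⟩
  have h1 := le_trans (le_abs_self _) this
  simp only at h1
  have h2 := le_abs_self C
  have : 0 ≤ (cut R x y) ^ 2 := sq_nonneg _
  have : 0 ≤ 2 * (cut R x y) ^ 2 * B ^ 2 + 16 * ((cut1 R x y) ^ 2 + (cut1 R y x) ^ 2)
      + 2 * |cut R x y * (cut2 R x y + cut2 R y x)| := by positivity
  constructor <;> linarith

lemma bern_alg1 {B w wx wy Lw f f1 f2 D : ℝ} (hB : 0 ≤ B) (hw : w < 0)
    (hL : -(B * (|wx| + |wy|)) ≤ Lw) :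
    2 * f ^ 2 * w * Lw - 8 * f * w * (f1 * wx + f2 * wy) - 2 * f * D * w ^ 2
      - 2 * (f1 ^ 2 + f2 ^ 2) * w ^ 2 - 2 * f ^ 2 * (wx ^ 2 + wy ^ 2)
      ≤ (2 * f ^ 2 * B ^ 2 + 16 * (f1 ^ 2 + f2 ^ 2) + 2 * |f * D|) * w ^ 2 := by
  have h1 : w * Lw ≤ -w * (B * (|wx| + |wy|)) := by nlinarith
  have h2 : 2 * f ^ 2 * (w * Lw) ≤ 2 * f ^ 2 * (-w * (B * (|wx| + |wy|))) :=
    mul_le_mul_of_nonneg_left h1 (by positivity)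
  have ex : |wx| ^ 2 = wx ^ 2 := sq_abs _
  have ey : |wy| ^ 2 = wy ^ 2 := sq_abs _
  have h3 : 2 * f ^ 2 * (-w * (B * |wx|)) ≤ f ^ 2 * wx ^ 2 + f ^ 2 * B ^ 2 * w ^ 2 := by
    rw [← ex]; nlinarith [mul_nonneg (sq_nonneg f) (sq_nonneg (|wx| + w * B))]
  have h4 : 2 * f ^ 2 * (-w * (B * |wy|)) ≤ f ^ 2 * wy ^ 2 + f ^ 2 * B ^ 2 * w ^ 2 := by
    rw [← ey]; nlinarith [mul_nonneg (sq_nonneg f) (sq_nonneg (|wy| + w * B))]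
  have h5 : - 8 * f * w * (f1 * wx) ≤ f ^ 2 * wx ^ 2 + 16 * f1 ^ 2 * w ^ 2 := by
    nlinarith [sq_nonneg (f * wx + 4 * f1 * w)]
  have h6 : - 8 * f * w * (f2 * wy) ≤ f ^ 2 * wy ^ 2 + 16 * f2 ^ 2 * w ^ 2 := by
    nlinarith [sq_nonneg (f * wy + 4 * f2 * w)]
  have h7 : -(2 * f * D * w ^ 2) ≤ 2 * |f * D| * w ^ 2 := by
    nlinarith [mul_nonneg (sub_nonneg.2 (neg_le_abs (f * D))) (sq_nonneg w), neg_abs_le (f * D), sq_nonneg w]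
  nlinarith [mul_nonneg (sq_nonneg f1) (sq_nonneg w), mul_nonneg (sq_nonneg f2) (sq_nonneg w)]

lemma bern_alg2 {B d dx dy Ld : ℝ} (hB : 0 ≤ B) (hL : |Ld| ≤ B * (|dx| + |dy|)) :
    2 * d * Ld - 2 * (dx ^ 2 + dy ^ 2) ≤ 2 * B ^ 2 * d ^ 2 - dx ^ 2 - dy ^ 2 := by
  have h1 : d * Ld ≤ |d| * (B * (|dx| + |dy|)) := by
    calc d * Ld ≤ |d * Ld| := le_abs_self _
      _ = |d| * |Ld| := abs_mul _ _
      _ ≤ _ := mul_le_mul_of_nonneg_left hL (abs_nonneg _)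
  rw [← sq_abs dx, ← sq_abs dy, ← sq_abs d]
  nlinarith [sq_nonneg (|d| * B - |dx|), sq_nonneg (|d| * B - |dy|)]

/-- jets of auxiliary functions together with two sided inequality -/
def Two (d : ℝ → ℝ → ℝ → ℝ) (B dx dy x y t : ℝ) : Prop :=
  ∃ dxx dyy dt, J2 (fun s => d s y t) x dx dxx ∧ J2 (fun s => d x s t) y dy dyy ∧
    HasDerivAt (fun s => d x y s) dt t ∧ |dt - dxx - dyy| ≤ B * (|dx| + |dy|)

set_option maxHeartbeats 2000000 in
lemma bern (R T t0 B M C0 W0 : ℝ) (hB : 0 ≤ B) (hC0 : 0 ≤ C0) :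
    ∃ C : ℝ, ∀ (t1 : ℝ) (w d e : ℝ → ℝ → ℝ → ℝ), t1 ≤ T →
    ContinuousOn (fun q : ℝ × ℝ × ℝ => w q.1 q.2.1 q.2.2) (Cyl (R ^ 2 / 4) (4 * R ^ 2) t0 t1) →
    ContinuousOn (fun q : ℝ × ℝ × ℝ => d q.1 q.2.1 q.2.2) (Cyl (R ^ 2 / 4) (4 * R ^ 2) t0 t1) →
    ContinuousOn (fun q : ℝ × ℝ × ℝ => e q.1 q.2.1 q.2.2) (Cyl (R ^ 2 / 4) (4 * R ^ 2) t0 t1) →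
    (∀ x y t, R ^ 2 / 4 < x ^ 2 + y ^ 2 → x ^ 2 + y ^ 2 < 4 * R ^ 2 → 0 < y → t0 < t → t ≤ t1 →
      Spr w B x y t ∧ ∃ dx dy ex ey, Two d B dx dy x y t ∧ Two e B ex ey x y t ∧
        w x y t ^ 2 ≤ 8 * (dx ^ 2 + ey ^ 2) + C0) →
    (∀ x y t, R ^ 2 / 4 ≤ x ^ 2 + y ^ 2 → x ^ 2 + y ^ 2 ≤ 4 * R ^ 2 → 0 ≤ y → t0 ≤ t → t ≤ t1 →
      d x y t ^ 2 ≤ M ∧ e x y t ^ 2 ≤ M) →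
    (∀ x t, x ^ 2 ≤ 4 * R ^ 2 → t0 ≤ t → t ≤ t1 → 0 ≤ w x 0 t) →
    (∀ x y, x ^ 2 + y ^ 2 ≤ 4 * R ^ 2 → 0 ≤ y → w x y t0 ^ 2 ≤ W0) →
    ∀ x y t, R ^ 2 / 4 ≤ x ^ 2 + y ^ 2 → x ^ 2 + y ^ 2 ≤ 4 * R ^ 2 → 0 ≤ y → t0 ≤ t → t ≤ t1 →
      w x y t ≤ 0 → (cut R x y * w x y t) ^ 2 ≤ C := by
  obtain ⟨C1, hC1, hcut⟩ := cut_bound R B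
  set A := 8 * C1 with hA
  set Λ := C1 * C0 + A * (4 * B ^ 2 * |M|) + 1 with hΛ
  have hΛ0 : 0 ≤ Λ := by positivity
  refine ⟨C1 * |W0| + 2 * A * |M| + Λ * (T - t0), ?_⟩
  intro t1 w d e ht1 hwc hdc hec hint hbd hbot hini x y t p1 p2 p3 p4 p5 p6
  have hM := le_abs_self M
  have hW := le_abs_self W0
  set P := Cyl (R ^ 2 / 4) (4 * R ^ 2) t0 t1 with hP
  set S := P ∩ (fun q : ℝ × ℝ × ℝ => w q.1 q.2.1 q.2.2) ⁻¹' (Iic 0) with hS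
  have hScomp : IsCompact S := by
    refine (cyl_compact _ _ _ _).of_isClosed_subset ?_ inter_subset_left
    exact hwc.preimage_isClosed_of_isClosed (cyl_compact _ _ _ _).isClosed isClosed_Iic
  let Ψ : ℝ → ℝ → ℝ → ℝ := fun x y t => (cut R x y * w x y t) * (cut R x y * w x y t)
      + A * (d x y t * d x y t + e x y t * e x y t)
  have hcutc : Continuous (fun q : ℝ × ℝ × ℝ => cut R q.1 q.2.1) := by unfold cut; fun_prop
  have hΨc : ContinuousOn (fun q : ℝ × ℝ × ℝ => Ψ q.1 q.2.1 q.2.2 - Λ * (q.2.2 - t0)) S := by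
    have hw' := hwc.mono (inter_subset_left : S ⊆ P)
    have hd' := hdc.mono (inter_subset_left : S ⊆ P)
    have he' := hec.mono (inter_subset_left : S ⊆ P)
    have hc' := hcutc.continuousOn (s := S)
    exact (((hc'.mul hw').mul (hc'.mul hw')).add
      (((hd'.mul hd').add (he'.mul he')).const_smul A)).sub (by fun_prop)
  have hmem : (x, y, t) ∈ S := ⟨⟨p1, p2, p3, p4, p5⟩, p6⟩
  obtain ⟨⟨X, Y, s⟩, hq, hmax⟩ := hScomp.exists_isMaxOn ⟨_, hmem⟩ hΨc
  have hmax' : ∀ a b c, R ^ 2 / 4 ≤ a ^ 2 + b ^ 2 → a ^ 2 + b ^ 2 ≤ 4 * R ^ 2 → 0 ≤ b → t0 ≤ c →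
      c ≤ t1 → w a b c ≤ 0 → Ψ a b c - Λ * (c - t0) ≤ Ψ X Y s - Λ * (s - t0) :=
    fun a b c k1 k2 k3 k4 k5 k6 =>
      hmax (show (a, b, c) ∈ S from ⟨⟨k1, k2, k3, k4, k5⟩, k6⟩)
  obtain ⟨⟨q1, q2, q3, q4, q5⟩, q6⟩ := hq
  simp only [mem_preimage, mem_Iic] at q1 q2 q3 q4 q5 q6
  have hA0 : 0 < A := by positivity
  have hsmall : ∀ v, (cut R X Y * w X Y s) ^ 2 ≤ v → Ψ X Y s - Λ * (s - t0) ≤ v + 2 * A * |M| := by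
    intro v hv
    obtain ⟨b1, b2⟩ := hbd X Y s q1 q2 q3 q4 q5
    have : 0 ≤ Λ * (s - t0) := mul_nonneg hΛ0 (by linarith)
    simp only [Ψ]
    nlinarith
  have goal : Ψ X Y s - Λ * (s - t0) ≤ C1 * |W0| + 2 * A * |M| := by
    have hpos : 0 ≤ C1 * |W0| := by positivity
    rcases q6.eq_or_lt with h | q6
    · exact hsmall _ (by rw [h]; simpa using hpos)
    rcases q3.eq_or_lt with h | q3
    · rw [← h] at q2 q6
      exact absurd (hbot X s (by nlinarith) q4 q5) (not_le.2 q6)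
    rcases q4.eq_or_lt with h | q4
    · refine hsmall _ ?_
      rw [mul_pow, ← h]
      exact mul_le_mul (hcut X Y q2).1 ((hini X Y q2 q3.le).trans hW) (sq_nonneg _) hC1.le
    rcases q1.eq_or_lt with h | q1
    · refine hsmall _ ?_
      have : cut R X Y = 0 := by unfold cut; rw [← h]; simp
      rw [this]; simpa using hpos
    rcases q2.eq_or_lt with h | q2
    · refine hsmall _ ?_
      have : cut R X Y = 0 := by unfold cut; rw [h]; simp
      rw [this]; simpa using hpos
    exfalso
    obtain ⟨⟨wx, wy, wxx, wyy, wt, jx, jy, jt, hin⟩, dx, dy, ex, ey,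
      ⟨dxx, dyy, dt, djx, djy, djt, hd⟩, ⟨exx, eyy, et, ejx, ejy, ejt, he⟩, hw2⟩ :=
      hint X Y s q1 q2 q3 q4 q5
    have cx := (cut_j R X Y).mul jx
    have cy0 := cut_j R Y X
    simp only [cut_symm R _ X] at cy0
    have cy := cy0.mul jy
    have mx := ((cx.mul cx).add (((djx.mul djx).add (ejx.mul ejx)).cmul A)).max (by
      have hcont := jx.hasDerivAt.continuousAt.eventually (gt_mem_nhds q6)
      filter_upwards [ev_x q1 q2, hcont] with a ha ha'
      have := hmax' a Y s ha.1.le ha.2.le q3.le q4.le q5 ha'.le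
      simp only [Ψ] at this
      linarith)
    have my := ((cy.mul cy).add (((djy.mul djy).add (ejy.mul ejy)).cmul A)).max (by
      have hcont := jy.hasDerivAt.continuousAt.eventually (gt_mem_nhds q6)
      filter_upwards [ev_y q1 q2 q3, hcont] with a ha ha'
      have := hmax' X a s ha.1.le ha.2.1.le ha.2.2.le q4.le q5 ha'.le
      simp only [Ψ] at this
      linarith)
    have ct := jt.const_mul (cut R X Y)
    have mt := time_max (f := fun a => Ψ X Y a - Λ * (a - t0)) (t := s) q4
      (((ct.mul ct).add (((djt.mul djt).add (ejt.mul ejt)).const_mul A)).sub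
        (((hasDerivAt_id s).sub_const t0).const_mul Λ)) (by
        have hcont := jt.continuousAt.eventually (gt_mem_nhds q6)
        filter_upwards [hcont] with a ha k1 k2
        exact hmax' X Y a q1.le q2.le q3.le k1 (by linarith) ha.le)
    have mx := mx.2
    have my := my.2
    have a1 := bern_alg1 (f := cut R X Y) (f1 := cut1 R X Y) (f2 := cut1 R Y X)
      (D := cut2 R X Y + cut2 R Y X) hB q6 hin
    have a2 := bern_alg2 (d := d X Y s) hB hd
    have a3 := bern_alg2 (d := e X Y s) hB he
    have a4 := mul_le_mul_of_nonneg_right (hcut X Y q2.le).2 (sq_nonneg (w X Y s))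
    obtain ⟨b1, b2⟩ := hbd X Y s q1.le q2.le q3.le q4.le q5
    have a5 := mul_le_mul_of_nonneg_left hw2 hC1.le
    have a6 : A * ((2 * d X Y s * (dt - dxx - dyy) - 2 * (dx ^ 2 + dy ^ 2)) +
        (2 * e X Y s * (et - exx - eyy) - 2 * (ex ^ 2 + ey ^ 2))) ≤
        A * (4 * B ^ 2 * |M| - dx ^ 2 - ey ^ 2) := by
      apply mul_le_mul_of_nonneg_left _ hA0.le
      have : B ^ 2 * d X Y s ^ 2 ≤ B ^ 2 * |M| := mul_le_mul_of_nonneg_left (b1.trans hM) (sq_nonneg _)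
      have : B ^ 2 * e X Y s ^ 2 ≤ B ^ 2 * |M| := mul_le_mul_of_nonneg_left (b2.trans hM) (sq_nonneg _)
      nlinarith [sq_nonneg dy, sq_nonneg ex]
    have fin : (0:ℝ) ≤ (C1 * (8 * (dx ^ 2 + ey ^ 2) + C0)) + A * (4 * B ^ 2 * |M| - dx ^ 2 - ey ^ 2) - Λ := by
      refine le_trans ?_ (sub_le_sub_right (add_le_add (a1.trans (a4.trans a5)) a6) Λ)
      linarith only [mx, my, mt]
    rw [hΛ, hA] at fin
    linarith
  have := hmax' x y t p1 p2 p3 p4 p5 p6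
  have h1 : (cut R x y * w x y t) ^ 2 ≤ Ψ x y t := by
    simp only [Ψ]
    nlinarith [mul_self_nonneg (d x y t), mul_self_nonneg (e x y t)]
  have h2 : Λ * (t - t0) ≤ Λ * (T - t0) := mul_le_mul_of_nonneg_left (by linarith) hΛ0
  linarith


lemma pow_lip {p G a b : ℝ} (hp : 2 < p) (ha : 0 ≤ a) (ha' : a ≤ G) (hb : 0 ≤ b) (hb' : b ≤ G) :
    |a ^ p - b ^ p| ≤ p * G ^ (p - 1) * |a - b| := by
  have := (convex_Icc 0 G).norm_image_sub_le_of_norm_hasDerivWithin_le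
    (f := fun x : ℝ => x ^ p) (f' := fun x => p * x ^ (p - 1)) (C := p * G ^ (p - 1))
    (fun x hx => (Real.hasDerivAt_rpow_const (Or.inr (by linarith))).hasDerivWithinAt)
    (fun x hx => by
      rw [Real.norm_eq_abs, abs_of_nonneg (mul_nonneg (by linarith) (Real.rpow_nonneg hx.1 _))]
      exact mul_le_mul_of_nonneg_left (Real.rpow_le_rpow hx.1 hx.2 (by linarith)) (by linarith))
    (show b ∈ Icc 0 G from ⟨hb, hb'⟩) (show a ∈ Icc 0 G from ⟨ha, ha'⟩)
  simpa [Real.norm_eq_abs] using this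

lemma nrm_eq (a b : ℝ) : Real.sqrt (a ^ 2 + b ^ 2) = ‖(⟨a, b⟩ : ℂ)‖ := by
  rw [Complex.norm_eq_sqrt_sq_add_sq]

lemma nrm_lip (a b c d : ℝ) :
    |Real.sqrt (a ^ 2 + b ^ 2) - Real.sqrt (c ^ 2 + d ^ 2)| ≤ |a - c| + |b - d| := by
  rw [nrm_eq, nrm_eq]
  refine (abs_norm_sub_norm_le _ _).trans ?_
  refine (Complex.norm_le_abs_re_add_abs_im _).trans ?_
  simp

lemma nrm_mid (a b c d : ℝ) :
    Real.sqrt (((a + c) / 2) ^ 2 + ((b + d) / 2) ^ 2) ≤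
      (Real.sqrt (a ^ 2 + b ^ 2) + Real.sqrt (c ^ 2 + d ^ 2)) / 2 := by
  rw [nrm_eq, nrm_eq, nrm_eq]
  have h : (⟨(a + c) / 2, (b + d) / 2⟩ : ℂ) = (1 / 2 : ℝ) • ((⟨a, b⟩ : ℂ) + ⟨c, d⟩) := by
    apply Complex.ext <;> simp <;> ring
  rw [h, norm_smul]
  have := norm_add_le (⟨a, b⟩ : ℂ) ⟨c, d⟩
  rw [Real.norm_of_nonneg (by norm_num)]
  linarith

lemma pow_mid {p a b : ℝ} (hp : 2 < p) (ha : 0 ≤ a) (hb : 0 ≤ b) :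
    2 * ((a + b) / 2) ^ p ≤ a ^ p + b ^ p := by
  have := (convexOn_rpow (p := p) (by linarith)).2 (show a ∈ Ici 0 from ha) (show b ∈ Ici 0 from hb)
    (show (0:ℝ) ≤ 1 / 2 by norm_num) (show (0:ℝ) ≤ 1 / 2 by norm_num) (by norm_num)
  simp only [smul_eq_mul] at this
  have e : 1 / 2 * a + 1 / 2 * b = (a + b) / 2 := by ring
  rw [e] at this
  linarith

lemma grad_nonneg (u : ℝ → ℝ → ℝ → ℝ) (x y t : ℝ) : 0 ≤ gradNorm u x y t := Real.sqrt_nonneg _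

lemma pdx_le (u : ℝ → ℝ → ℝ → ℝ) (x y t : ℝ) : |pdx u x y t| ≤ gradNorm u x y t :=
  Real.abs_le_sqrt (by nlinarith [sq_nonneg (pdy u x y t)])

lemma pdy_le (u : ℝ → ℝ → ℝ → ℝ) (x y t : ℝ) : |pdy u x y t| ≤ gradNorm u x y t :=
  Real.abs_le_sqrt (by nlinarith [sq_nonneg (pdx u x y t)])

lemma u_jets {p L T : ℝ} {u : ℝ → ℝ → ℝ → ℝ} (hsol : ClassicalSolution p L T u) {x y t : ℝ}
    (hx : |x| < L) (hy : y ∈ Ioo (0:ℝ) L) (ht : t ∈ Ioo 0 T) :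
    J2 (fun s => u s y t) x (pdx u x y t) (pdxx u x y t) ∧
    J2 (fun s => u x s t) y (pdy u x y t) (pdyy u x y t) ∧
    HasDerivAt (fun s => u x y s) (pdt u x y t) t := by
  have hy' : y ∈ Icc (0:ℝ) L := ⟨hy.1.le, hy.2.le⟩
  obtain ⟨c1, c2, c3, c4, c5, -⟩ := hsol.smooth hx.le hy' ht
  refine ⟨⟨fun s => pdx u s y t, ?_, rfl, c4.hasDerivAt⟩, ⟨fun s => pdy u x s t, ?_, rfl, c5.hasDerivAt⟩,
    c3.hasDerivAt⟩
  · have : ∀ᶠ s in nhds x, |s| < L := continuous_abs.continuousAt.eventually (gt_mem_nhds hx)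
    filter_upwards [this] with s hs
    exact (hsol.smooth hs.le hy' ht).1.hasDerivAt
  · filter_upwards [Ioo_mem_nhds hy.1 hy.2] with s hs
    exact (hsol.smooth hx.le ⟨hs.1.le, hs.2.le⟩ ht).2.1.hasDerivAt

lemma diff_two {p L T : ℝ} (hp : 2 < p) {u : ℝ → ℝ → ℝ → ℝ} (hsol : ClassicalSolution p L T u)
    {x y t a b c G : ℝ} (k m : ℝ)
    (hx : |x| < L) (hy : y ∈ Ioo (0:ℝ) L) (ht : t ∈ Ioo 0 T)
    (hx' : |x + a| < L) (hy' : y + b ∈ Ioo (0:ℝ) L) (ht' : t + c ∈ Ioo 0 T)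
    (hG : gradNorm u x y t ≤ G) (hG' : gradNorm u (x + a) (y + b) (t + c) ≤ G) :
    Two (fun x y t => k + m * (u (x + a) (y + b) (t + c) - u x y t)) (p * G ^ (p - 1))
      (m * (pdx u (x + a) (y + b) (t + c) - pdx u x y t))
      (m * (pdy u (x + a) (y + b) (t + c) - pdy u x y t)) x y t := by
  obtain ⟨j1, j2, j3⟩ := u_jets hsol hx hy ht
  obtain ⟨i1, i2, i3⟩ := u_jets hsol hx' hy' ht'
  refine ⟨m * (pdxx u (x + a) (y + b) (t + c) - pdxx u x y t),
    m * (pdyy u (x + a) (y + b) (t + c) - pdyy u x y t),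
    m * (pdt u (x + a) (y + b) (t + c) - pdt u x y t), ?_, ?_, ?_, ?_⟩
  · have := (J2.const k x).add (((i1.shift a).add (j1.cmul (-1))).cmul m)
    convert this using 1 <;> [(ext s; ring); ring; ring]
  · have := (J2.const k y).add (((i2.shift b).add (j2.cmul (-1))).cmul m)
    convert this using 1 <;> [(ext s; ring); ring; ring]
  · have := ((((i3.comp_add_const t c).sub j3).const_mul m).const_add k)
    exact this
  · have e1 := hsol.pde hx hy ht
    have e2 := hsol.pde hx' hy' ht'
    have e3 : m * (pdt u (x + a) (y + b) (t + c) - pdt u x y t)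
        - m * (pdxx u (x + a) (y + b) (t + c) - pdxx u x y t)
        - m * (pdyy u (x + a) (y + b) (t + c) - pdyy u x y t)
        = m * (gradNorm u (x + a) (y + b) (t + c) ^ p - gradNorm u x y t ^ p) := by
      rw [← e1, ← e2]; ring
    rw [e3, abs_mul, abs_mul, abs_mul]
    have h1 := pow_lip hp (grad_nonneg u (x + a) (y + b) (t + c)) hG' (grad_nonneg u x y t) hG
    have h2 := nrm_lip (pdx u (x + a) (y + b) (t + c)) (pdy u (x + a) (y + b) (t + c))
      (pdx u x y t) (pdy u x y t)
    have hG0 : 0 ≤ G := (grad_nonneg u x y t).trans hG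
    have h3 : 0 ≤ p * G ^ (p - 1) := mul_nonneg (by linarith) (Real.rpow_nonneg hG0 _)
    calc _ ≤ |m| * (p * G ^ (p - 1) * (|pdx u (x + a) (y + b) (t + c) - pdx u x y t| +
          |pdy u (x + a) (y + b) (t + c) - pdy u x y t|)) :=
          mul_le_mul_of_nonneg_left (h1.trans (mul_le_mul_of_nonneg_left h2 h3)) (abs_nonneg _)
      _ = _ := by ring

lemma Two.spr {d : ℝ → ℝ → ℝ → ℝ} {B dx dy x y t : ℝ} (h : Two d B dx dy x y t) : Spr d B x y t := by
  obtain ⟨a, b, c, h1, h2, h3, h4⟩ := h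
  exact ⟨_, _, _, _, _, h1, h2, h3, (abs_le.1 h4).1⟩

lemma diff_second {p L T : ℝ} (hp : 2 < p) {u : ℝ → ℝ → ℝ → ℝ} (hsol : ClassicalSolution p L T u)
    {x y t h G : ℝ} (hh : 0 < h)
    (hx : |x| < L) (hy : y ∈ Ioo (0:ℝ) L) (ht : t ∈ Ioo 0 T)
    (hx' : |x + h| < L) (hx'' : |x + -h| < L)
    (hG : gradNorm u x y t ≤ G) (hG' : gradNorm u (x + h) y t ≤ G)
    (hG'' : gradNorm u (x + -h) y t ≤ G) :
    Spr (fun x y t => (h ^ 2)⁻¹ * (u (x + h) y t + u (x + -h) y t - 2 * u x y t))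
      (p * G ^ (p - 1)) x y t := by
  obtain ⟨j1, j2, j3⟩ := u_jets hsol hx hy ht
  obtain ⟨i1, i2, i3⟩ := u_jets hsol hx' hy ht
  obtain ⟨k1, k2, k3⟩ := u_jets hsol hx'' hy ht
  have hm : 0 < (h ^ 2)⁻¹ := by positivity
  set m := (h ^ 2)⁻¹
  refine ⟨m * (pdx u (x + h) y t + pdx u (x + -h) y t - 2 * pdx u x y t),
    m * (pdy u (x + h) y t + pdy u (x + -h) y t - 2 * pdy u x y t),
    m * (pdxx u (x + h) y t + pdxx u (x + -h) y t - 2 * pdxx u x y t),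
    m * (pdyy u (x + h) y t + pdyy u (x + -h) y t - 2 * pdyy u x y t),
    m * (pdt u (x + h) y t + pdt u (x + -h) y t - 2 * pdt u x y t), ?_, ?_, ?_, ?_⟩
  · have := (((i1.shift h).add (k1.shift (-h))).add (j1.cmul (-2))).cmul m
    convert this using 1 <;> [(ext s; ring); ring; ring]
  · have := ((i2.add k2).add (j2.cmul (-2))).cmul m
    convert this using 1 <;> [(ext s; ring); ring; ring]
  · exact ((i3.add k3).sub (j3.const_mul 2)).const_mul m
  · have e1 := hsol.pde hx hy ht
    have e2 := hsol.pde hx' hy ht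
    have e4 := hsol.pde hx'' hy ht
    have hG0 : 0 ≤ G := (grad_nonneg u x y t).trans hG
    have h3 : 0 ≤ p * G ^ (p - 1) := mul_nonneg (by linarith) (Real.rpow_nonneg hG0 _)
    set N := Real.sqrt (((pdx u (x + h) y t + pdx u (x + -h) y t) / 2) ^ 2 +
      ((pdy u (x + h) y t + pdy u (x + -h) y t) / 2) ^ 2) with hN
    have n0 : 0 ≤ N := Real.sqrt_nonneg _
    have n1 : N ≤ (gradNorm u (x + h) y t + gradNorm u (x + -h) y t) / 2 := nrm_mid _ _ _ _
    have n2 := pow_mid hp (grad_nonneg u (x + h) y t) (grad_nonneg u (x + -h) y t)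
    have n3 := Real.rpow_le_rpow n0 n1 (show 0 ≤ p by linarith)
    have n4 := pow_lip hp n0 (by linarith : N ≤ G) (grad_nonneg u x y t) hG
    have n5 : |N - gradNorm u x y t| ≤ _ := nrm_lip ((pdx u (x + h) y t + pdx u (x + -h) y t) / 2)
      ((pdy u (x + h) y t + pdy u (x + -h) y t) / 2) (pdx u x y t) (pdy u x y t)
    have n6 := (abs_le.1 (n4.trans (mul_le_mul_of_nonneg_left n5 h3))).1
    have hx2 : |(pdx u (x + h) y t + pdx u (x + -h) y t) / 2 - pdx u x y t| =
        |pdx u (x + h) y t + pdx u (x + -h) y t - 2 * pdx u x y t| / 2 := by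
      rw [← abs_of_pos (show (0:ℝ) < 2 by norm_num), ← abs_div, abs_of_pos (show (0:ℝ) < 2 by norm_num)]
      congr 1; ring
    have hy2 : |(pdy u (x + h) y t + pdy u (x + -h) y t) / 2 - pdy u x y t| =
        |pdy u (x + h) y t + pdy u (x + -h) y t - 2 * pdy u x y t| / 2 := by
      rw [← abs_of_pos (show (0:ℝ) < 2 by norm_num), ← abs_div, abs_of_pos (show (0:ℝ) < 2 by norm_num)]
      congr 1; ring
    rw [hx2, hy2] at n6
    rw [abs_mul, abs_mul, abs_of_pos hm]
    have fin : -(p * G ^ (p - 1) * (|pdx u (x + h) y t + pdx u (x + -h) y t - 2 * pdx u x y t| +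
        |pdy u (x + h) y t + pdy u (x + -h) y t - 2 * pdy u x y t|)) ≤
        gradNorm u (x + h) y t ^ p + gradNorm u (x + -h) y t ^ p - 2 * gradNorm u x y t ^ p := by
      linarith
    have := mul_le_mul_of_nonneg_left fin hm.le
    rw [← e1, ← e2, ← e4] at this
    linarith

/-- uniform continuity near a compact set -/
lemma unif_cont {F : ℝ × ℝ × ℝ → ℝ} {K : Set (ℝ × ℝ × ℝ)} (hK : IsCompact K)
    (hF : ∀ q ∈ K, ContinuousAt F q) {ε : ℝ} (hε : 0 < ε) :
    ∃ d > 0, ∀ q ∈ K, ∀ q', dist q q' < d → |F q' - F q| < ε := by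
  have := hK.uniformContinuousAt_of_continuousAt F hF (Metric.dist_mem_uniformity hε)
  obtain ⟨d, hd, h⟩ := Metric.mem_uniformity_dist.1 this
  refine ⟨d, hd, fun q hq q2 hqq => ?_⟩
  have := h hqq hq
  change dist (F q) (F q2) < ε at this
  rw [dist_comm, Real.dist_eq] at this
  exact this

lemma close_lem {F F' : ℝ → ℝ → ℝ → ℝ} {K : Set (ℝ × ℝ × ℝ)} (hK : IsCompact K)
    (hF : ∀ q ∈ K, ContinuousAt (fun q : ℝ × ℝ × ℝ => F' q.1 q.2.1 q.2.2) q) (a b c : ℝ)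
    {h1 : ℝ} (hh1 : 0 < h1)
    (hd : ∀ q ∈ K, ∀ s ∈ Icc 0 h1, HasDerivAt (fun s => F (q.1 + s * a) (q.2.1 + s * b) (q.2.2 + s * c))
      (F' (q.1 + s * a) (q.2.1 + s * b) (q.2.2 + s * c)) s) {ε : ℝ} (hε : 0 < ε) :
    ∀ᶠ h in nhdsWithin 0 (Ioi 0), ∀ x y t, (x, y, t) ∈ K →
      |(h⁻¹ * (F (x + h * a) (y + h * b) (t + h * c) - F x y t)) - F' x y t| ≤ ε := by
  obtain ⟨d, hd0, hu⟩ := unif_cont hK hF hε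
  have hM : 0 < |a| + |b| + |c| + 1 := by positivity
  set M := |a| + |b| + |c| + 1
  have hh : 0 < min h1 (d / M) := lt_min hh1 (by positivity)
  filter_upwards [Ioo_mem_nhdsGT hh] with h hhI x y t hq
  have hpos := hhI.1
  have hlt1 := hhI.2.trans_le (min_le_left _ _)
  have hlt2 := hhI.2.trans_le (min_le_right _ _)
  obtain ⟨s, hs, hs'⟩ := exists_hasDerivAt_eq_slope
    (fun s => F (x + s * a) (y + s * b) (t + s * c)) (fun s => F' (x + s * a) (y + s * b) (t + s * c))
    hpos (fun s hs => (hd _ hq s ⟨hs.1, hs.2.trans hlt1.le⟩).continuousAt.continuousWithinAt)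
    (fun s hs => hd _ hq s ⟨hs.1.le, hs.2.le.trans hlt1.le⟩)
  have e : h⁻¹ * (F (x + h * a) (y + h * b) (t + h * c) - F x y t) =
      F' (x + s * a) (y + s * b) (t + s * c) := by
    rw [hs']; simp [div_eq_inv_mul]
  rw [e]
  have hsM : s * M < d := by
    have := (lt_div_iff₀ hM).1 (hs.2.trans hlt2)
    exact this
  refine (hu (x, y, t) hq (x + s * a, y + s * b, t + s * c) ?_).le
  have key : ∀ a', |a'| ≤ M → ∀ z : ℝ, dist z (z + s * a') < d := by
    intro a' ha z
    rw [Real.dist_eq]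
    have : z - (z + s * a') = -(s * a') := by ring
    rw [this, abs_neg, abs_mul, abs_of_pos hs.1]
    exact (mul_le_mul_of_nonneg_left ha hs.1.le).trans_lt hsM
  have A1 := abs_nonneg a
  have A2 := abs_nonneg b
  have A3 := abs_nonneg c
  rw [Prod.dist_eq, Prod.dist_eq]
  refine max_lt (key a (by simp only [M]; linarith) x) (max_lt (key b (by simp only [M]; linarith) y) (key c (by simp only [M]; linarith) t))


lemma abs_of_disc {x y r L : ℝ} (hr : 0 ≤ r) (h : x ^ 2 + y ^ 2 ≤ r ^ 2) (hL : r ≤ L) : |x| ≤ L :=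
  (abs_le_of_sq_le_sq (by nlinarith [sq_nonneg y]) hr).trans hL

lemma shift_bds {x y x' y' R h : ℝ} (hR : 0 < R) (hh : h ≤ R / 64) (hx : |x' - x| ≤ h)
    (hy : |y' - y| ≤ h) (hxy : x ^ 2 + y ^ 2 ≤ 4 * R ^ 2) :
    x' ^ 2 + y' ^ 2 ≤ 9 * R ^ 2 ∧ x ^ 2 + y ^ 2 - 3 / 16 * R ^ 2 ≤ x' ^ 2 + y' ^ 2 := by
  have h0 : 0 ≤ h := (abs_nonneg _).trans hx
  have ax : |x| ≤ 2 * R := abs_of_disc (y := y) (by linarith) (by nlinarith) le_rfl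
  have ay : |y| ≤ 2 * R := abs_of_disc (y := x) (by linarith) (by nlinarith) le_rfl
  have bx : |x * (x' - x)| ≤ 2 * R * (R / 64) := by
    rw [abs_mul]; exact mul_le_mul ax (hx.trans hh) (abs_nonneg _) (by linarith)
  have bY : |y * (y' - y)| ≤ 2 * R * (R / 64) := by
    rw [abs_mul]; exact mul_le_mul ay (hy.trans hh) (abs_nonneg _) (by linarith)
  have sx : (x' - x) ^ 2 ≤ (R / 64) ^ 2 := sq_le_sq' (by linarith [(abs_le.1 hx).1]) ((le_abs_self _).trans (hx.trans hh))
  have sy : (y' - y) ^ 2 ≤ (R / 64) ^ 2 := sq_le_sq' (by linarith [(abs_le.1 hy).1]) ((le_abs_self _).trans (hy.trans hh))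
  have := abs_le.1 bx
  have := abs_le.1 bY
  constructor <;> nlinarith [sq_nonneg (x' - x), sq_nonneg (y' - y)]

section main
variable {p L T : ℝ} {u : ℝ → ℝ → ℝ → ℝ}

lemma sm (hL : 0 < L) (hsol : ClassicalSolution p L T u) {x y t : ℝ}
    (h : x ^ 2 + y ^ 2 ≤ 9 * (L / 4) ^ 2) (hy : 0 ≤ y) (h0 : 0 < t) (h1 : t < T) : C21At u x y t :=
  hsol.smooth (abs_of_disc (y := y) (r := 3 * (L / 4)) (by positivity) (by nlinarith) (by linarith))
    ⟨hy, (le_abs_self y).trans (abs_of_disc (y := x) (r := 3 * (L / 4)) (by positivity) (by nlinarith) (by linarith))⟩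
    ⟨h0, h1⟩

lemma dom_lt (hL : 0 < L) {x y : ℝ}
    (h : x ^ 2 + y ^ 2 ≤ 9 * (L / 4) ^ 2) : |x| < L ∧ y < L := by
  have h1 : |x| ≤ 3 * (L / 4) := abs_of_disc (y := y) (by positivity) (by nlinarith) le_rfl
  have h2 : |y| ≤ 3 * (L / 4) := abs_of_disc (y := x) (by positivity) (by nlinarith) le_rfl
  exact ⟨by linarith, by linarith [le_abs_self y]⟩

lemma ann_bound (hL : 0 < L) (hgbu : IsolatedGBU L T u) : ∃ G : ℝ, 0 ≤ G ∧ ∀ x y t,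
    (L / 4) ^ 2 / 16 ≤ x ^ 2 + y ^ 2 → x ^ 2 + y ^ 2 ≤ 9 * (L / 4) ^ 2 → 0 ≤ y → 0 < t → t < T →
    gradNorm u x y t ≤ G := by
  set K : Set (ℝ × ℝ) := (fun q : ℝ × ℝ × ℝ => (q.1, q.2.1)) '' Cyl ((L / 4) ^ 2 / 16) (9 * (L / 4) ^ 2) 0 0
  have hK : IsCompact K := (cyl_compact _ _ _ _).image (by fun_prop)
  obtain ⟨M, hM⟩ := hgbu.bounded K hK (by
    rintro _ ⟨⟨x, y, t⟩, ⟨h1, h2, h3, -, -⟩, rfl⟩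
    simp only at h1 h2 h3
    obtain ⟨a, b⟩ := dom_lt hL h2
    refine ⟨⟨⟨(abs_lt.1 a).1.le, (abs_lt.1 a).2.le⟩, h3, b.le⟩, ?_⟩
    simp only [mem_singleton_iff, Prod.mk.injEq]
    rintro ⟨rfl, rfl⟩
    have : 0 < L ^ 2 := by positivity
    nlinarith)
  refine ⟨|M|, abs_nonneg _, fun x y t h1 h2 h3 h4 h5 => (hM (x, y) ⟨(x, y, 0), ⟨h1, h2, h3, le_rfl, le_rfl⟩, rfl⟩ t ⟨h4, h5⟩).trans (le_abs_self _)⟩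

lemma disc_bound (hL : 0 < L) (hsol : ClassicalSolution p L T u) {a b : ℝ} (ha : 0 < a) (hb : b < T) :
    ∃ G : ℝ, 0 ≤ G ∧ ∀ x y t, x ^ 2 + y ^ 2 ≤ 9 * (L / 4) ^ 2 → 0 ≤ y → a ≤ t → t ≤ b →
    gradNorm u x y t ≤ G := by
  obtain ⟨C, hC⟩ := (cyl_compact (-1) (9 * (L / 4) ^ 2) a b).exists_bound_of_continuousOn
    (f := fun q : ℝ × ℝ × ℝ => gradNorm u q.1 q.2.1 q.2.2) (by
      rintro ⟨x, y, t⟩ ⟨h1, h2, h3, h4, h5⟩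
      simp only at h1 h2 h3 h4 h5
      obtain ⟨-, -, -, -, -, -, -, c1, c2, -⟩ := sm hL hsol h2 h3 (by linarith) (by linarith)
      exact (((c1.pow 2).add (c2.pow 2)).sqrt).continuousWithinAt)
  refine ⟨|C|, abs_nonneg _, fun x y t h1 h2 h3 h4 => ?_⟩
  have := hC (x, y, t) ⟨by simp only; nlinarith [sq_nonneg x, sq_nonneg y], h1, h2, h3, h4⟩
  exact (le_abs_self _).trans (this.trans (le_abs_self _))

lemma shift_cont (hL : 0 < L) (hsol : ClassicalSolution p L T u) {t0 t1 a b c : ℝ} (ht0 : 0 < t0) (ht1 : t1 < T)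
    (ha : |a| ≤ L / 4 / 64) (hb0 : 0 ≤ b) (hb : |b| ≤ L / 4 / 64) (hc : 0 < t0 + c) (hc' : t1 + c < T) :
    ContinuousOn (fun q : ℝ × ℝ × ℝ => u (q.1 + a) (q.2.1 + b) (q.2.2 + c)) (Cyl (-1) (4 * (L / 4) ^ 2) t0 t1) := by
  rintro ⟨x, y, t⟩ ⟨h1, h2, h3, h4, h5⟩
  simp only at h1 h2 h3 h4 h5
  have hs := shift_bds (x' := x + a) (y' := y + b) (R := L / 4) (h := L / 4 / 64) (by positivity) le_rfl
    (by simpa using ha) (by simpa using hb) h2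
  obtain ⟨-, -, -, -, -, -, c0, -⟩ := sm hL hsol hs.1 (by linarith) (show 0 < t + c by linarith) (by linarith)
  have hg : ContinuousAt (fun q : ℝ × ℝ × ℝ => (q.1 + a, q.2.1 + b, q.2.2 + c)) (x, y, t) := by fun_prop
  exact (ContinuousAt.comp (f := fun q : ℝ × ℝ × ℝ => (q.1 + a, q.2.1 + b, q.2.2 + c))
    (g := fun q : ℝ × ℝ × ℝ => u q.1 q.2.1 q.2.2) c0 hg).continuousWithinAt

/-- five closeness facts -/
lemma close_all (hL : 0 < L) (hT : 0 < T) (hsol : ClassicalSolution p L T u) {t1 : ℝ} (h1 : t1 < T) :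
    ∀ᶠ h in nhdsWithin (0:ℝ) (Ioi 0), ∀ x y t, (x, y, t) ∈ Cyl (-1) (4 * (L / 4) ^ 2) (T / 2) t1 →
      |(h⁻¹ * (u (x + h * 1) (y + h * 0) (t + h * 0) - u x y t)) - pdx u x y t| ≤ 1 ∧
      |(h⁻¹ * (u (x + h * 0) (y + h * 1) (t + h * 0) - u x y t)) - pdy u x y t| ≤ 1 ∧
      |(h⁻¹ * (u (x + h * 0) (y + h * 0) (t + h * 1) - u x y t)) - pdt u x y t| ≤ 1 ∧
      |(h⁻¹ * (pdx u (x + h * 1) (y + h * 0) (t + h * 0) - pdx u x y t)) - pdxx u x y t| ≤ 1 ∧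
      |(h⁻¹ * (pdy u (x + h * 0) (y + h * 1) (t + h * 0) - pdy u x y t)) - pdyy u x y t| ≤ 1 := by
  have hK := cyl_compact (-1) (4 * (L / 4) ^ 2) (T / 2) t1
  have hpos : 0 < min (L / 4 / 64) ((T - t1) / 2) := lt_min (by positivity) (by linarith)
  have hdom : ∀ q ∈ Cyl (-1) (4 * (L / 4) ^ 2) (T / 2) t1, ∀ s ∈ Icc 0 (min (L / 4 / 64) ((T - t1) / 2)),
      ∀ a b c : ℝ, |a| ≤ 1 → 0 ≤ b → |b| ≤ 1 → 0 ≤ c → c ≤ 1 →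
      C21At u (q.1 + s * a) (q.2.1 + s * b) (q.2.2 + s * c) := by
    rintro ⟨x, y, t⟩ ⟨k1, k2, k3, k4, k5⟩ s ⟨s0, s1⟩ a b c ha hb0 hb hc0 hc
    simp only at k1 k2 k3 k4 k5 ⊢
    have s2 := s1.trans (min_le_left _ _)
    have s3 := s1.trans (min_le_right _ _)
    have hs := shift_bds (x' := x + s * a) (y' := y + s * b) (R := L / 4) (h := L / 4 / 64) (by positivity) le_rfl
      (by rw [add_sub_cancel_left, abs_mul, abs_of_nonneg s0]; nlinarith [abs_nonneg a])
      (by rw [add_sub_cancel_left, abs_mul, abs_of_nonneg s0]; nlinarith [abs_nonneg b]) k2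
    have : 0 ≤ s * b := by positivity
    have : 0 ≤ s * c := by positivity
    have : s * c ≤ s := by nlinarith
    exact sm hL hsol hs.1 (by linarith) (by linarith) (by linarith)
  have hself : ∀ q ∈ Cyl (-1) (4 * (L / 4) ^ 2) (T / 2) t1, C21At u q.1 q.2.1 q.2.2 := by
    intro q hq
    have := hdom q hq 0 ⟨le_rfl, hpos.le⟩ 0 0 0 (by simp) le_rfl (by simp) le_rfl (by simp)
    simpa using this
  have sh : ∀ {g : ℝ → ℝ} {g' x s : ℝ}, HasDerivAt g g' (x + s * 1) → HasDerivAt (fun s => g (x + s * 1)) g' s := by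
    intro g g' x s h
    simp only [mul_one] at h ⊢
    rw [add_comm] at h
    have := h.comp_add_const s x
    simpa [add_comm] using this
  have e1 := close_lem (F := u) (F' := pdx u) hK (fun q hq => by
    obtain ⟨-, -, -, -, -, -, c0, c1, c2, c3, c4, c5, c6⟩ := hself q hq; exact c1) 1 0 0 hpos (fun q hq s hs => by
    obtain ⟨d1, d2, d3, d4, d5, -⟩ := hdom q hq s hs 1 0 0 (by simp) le_rfl (by simp) le_rfl (by simp)
    have := d1.hasDerivAt
    simp only [mul_zero] at this ⊢
    exact sh this) (zero_lt_one)
  have e2 := close_lem (F := u) (F' := pdy u) hK (fun q hq => by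
    obtain ⟨-, -, -, -, -, -, c0, c1, c2, c3, c4, c5, c6⟩ := hself q hq; exact c2) 0 1 0 hpos (fun q hq s hs => by
    obtain ⟨d1, d2, d3, d4, d5, -⟩ := hdom q hq s hs 0 1 0 (by simp) zero_le_one (by simp) le_rfl (by simp)
    have := d2.hasDerivAt
    simp only [mul_zero] at this ⊢
    exact sh this) (zero_lt_one)
  have e3 := close_lem (F := u) (F' := pdt u) hK (fun q hq => by
    obtain ⟨-, -, -, -, -, -, c0, c1, c2, c3, c4, c5, c6⟩ := hself q hq; exact c3) 0 0 1 hpos (fun q hq s hs => by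
    obtain ⟨d1, d2, d3, d4, d5, -⟩ := hdom q hq s hs 0 0 1 (by simp) le_rfl (by simp) zero_le_one le_rfl
    have := d3.hasDerivAt
    simp only [mul_zero] at this ⊢
    exact sh this) (zero_lt_one)
  have e4 := close_lem (F := pdx u) (F' := pdxx u) hK (fun q hq => by
    obtain ⟨-, -, -, -, -, -, c0, c1, c2, c3, c4, c5, c6⟩ := hself q hq; exact c4) 1 0 0 hpos (fun q hq s hs => by
    obtain ⟨d1, d2, d3, d4, d5, -⟩ := hdom q hq s hs 1 0 0 (by simp) le_rfl (by simp) le_rfl (by simp)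
    have := d4.hasDerivAt
    simp only [mul_zero] at this ⊢
    exact sh this) (zero_lt_one)
  have e5 := close_lem (F := pdy u) (F' := pdyy u) hK (fun q hq => by
    obtain ⟨-, -, -, -, -, -, c0, c1, c2, c3, c4, c5, c6⟩ := hself q hq; exact c5) 0 1 0 hpos (fun q hq s hs => by
    obtain ⟨d1, d2, d3, d4, d5, -⟩ := hdom q hq s hs 0 1 0 (by simp) zero_le_one (by simp) le_rfl (by simp)
    have := d5.hasDerivAt
    simp only [mul_zero] at this ⊢
    exact sh this) (zero_lt_one)
  filter_upwards [e1, e2, e3, e4, e5] with h a1 a2 a3 a4 a5 x y t hq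
  exact ⟨a1 x y t hq, a2 x y t hq, a3 x y t hq, a4 x y t hq, a5 x y t hq⟩

end main


section main5
variable {p L T : ℝ} {u : ℝ → ℝ → ℝ → ℝ}

lemma ev_small {ε : ℝ} (hε : 0 < ε) : ∀ᶠ h in nhdsWithin (0:ℝ) (Ioi 0), 0 < h ∧ h ≤ ε := by
  filter_upwards [Ioc_mem_nhdsGT hε] with h hh using hh

set_option maxHeartbeats 2000000 in
lemma main_low (hp : 2 < p) (hL : 0 < L) (hT : 0 < T) (hsol : ClassicalSolution p L T u)
    (hgbu : IsolatedGBU L T u) (W : ℝ → ℝ → ℝ → ℝ → ℝ) (W0 : ℝ → ℝ → ℝ → ℝ) (C0 N : ℝ) (hC0 : 0 ≤ C0)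
    (hyp : ∀ T', T / 2 ≤ T' → T' < T → ∀ᶠ h in nhdsWithin (0:ℝ) (Ioi 0),
      ContinuousOn (fun q : ℝ × ℝ × ℝ => W h q.1 q.2.1 q.2.2) (Cyl (-1) (4 * (L / 4) ^ 2) (T / 2) T') ∧
      (∀ x y t, (x, y, t) ∈ Cyl (-1) (4 * (L / 4) ^ 2) (T / 2) T' → |W h x y t - W0 x y t| ≤ 1) ∧
      (∀ x y t G, x ^ 2 + y ^ 2 ≤ 4 * (L / 4) ^ 2 → 0 < y → T / 2 ≤ t → t ≤ T' →
        (∀ x' y' t', |x' - x| ≤ h → |y' - y| ≤ h → 0 ≤ y' → |t' - t| ≤ h → gradNorm u x' y' t' ≤ G) →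
        Spr (W h) (p * G ^ (p - 1)) x y t) ∧
      (∀ x t, x ^ 2 ≤ 4 * (L / 4) ^ 2 → T / 2 ≤ t → t ≤ T' → 0 ≤ W h x 0 t))
    (hW0 : ∀ x y t, (L / 4) ^ 2 / 4 < x ^ 2 + y ^ 2 → x ^ 2 + y ^ 2 < 4 * (L / 4) ^ 2 → 0 < y → T / 2 < t → t < T →
      |W0 x y t| ≤ |pdxx u x y t| + |pdyy u x y t| + C0)
    (hini : ∀ x y, x ^ 2 + y ^ 2 ≤ 4 * (L / 4) ^ 2 → 0 ≤ y → |W0 x y (T / 2)| ≤ N) :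
    ∃ C, 0 ≤ C ∧ ∀ x y t, x ^ 2 + y ^ 2 ≤ (L / 4) ^ 2 → 0 ≤ y → T / 2 ≤ t → t < T → -C ≤ W0 x y t := by
  obtain ⟨G, hG0, hG⟩ := ann_bound hL hgbu
  set R := L / 4 with hRdef
  have hR : 0 < R := by positivity
  have hR2 : 0 < R ^ 2 := by positivity
  obtain ⟨C, hC⟩ := bern R T (T / 2) (p * G ^ (p - 1)) ((G + 1) ^ 2) (3 * (C0 + 3) ^ 2) ((N + 1) ^ 2)
    (by positivity) (by positivity)
  set K : ℝ := (3 / 4 * R ^ 2) * (3 * R ^ 2) with hK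
  have hKp : 0 < K := by positivity
  have hN0 : 0 ≤ N := (abs_nonneg _).trans (hini 0 0 (by nlinarith) le_rfl)
  set D : ℝ := (N + 1) + Real.sqrt C / K with hD
  have hD1 : N + 1 ≤ D := by rw [hD]; have : 0 ≤ Real.sqrt C / K := by positivity
                             linarith
  refine ⟨D + 1, by linarith, fun x₀ y₀ t₀ k1 k2 k3 k4 => ?_⟩
  have e1 := hyp t₀ k3 k4
  have e2 := close_all hL hT hsol k4
  have hm : 0 < min (R / 64) (min ((T - t₀) / 2) (T / 4)) :=
    lt_min (by positivity) (lt_min (by linarith) (by positivity))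
  obtain ⟨h, ⟨⟨w1, w2, w3, w4⟩, h2, ⟨hpos, hle⟩⟩⟩ := (e1.and (e2.and (ev_small hm))).exists
  have l1 := hle.trans (min_le_left _ _)
  have l2 := (hle.trans (min_le_right _ _)).trans (min_le_left _ _)
  have l3 := (hle.trans (min_le_right _ _)).trans (min_le_right _ _)
  have mem : ∀ {x y t : ℝ}, x ^ 2 + y ^ 2 ≤ 4 * R ^ 2 → 0 ≤ y → T / 2 ≤ t → t ≤ t₀ →
      (x, y, t) ∈ Cyl (-1) (4 * R ^ 2) (T / 2) t₀ := fun {x y t} a b c d =>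
    ⟨by simp only; nlinarith [sq_nonneg x, sq_nonneg y], a, b, c, d⟩
  have sub1 : Cyl (R ^ 2 / 4) (4 * R ^ 2) (T / 2) t₀ ⊆ Cyl (-1) (4 * R ^ 2) (T / 2) t₀ := by
    rintro ⟨x, y, t⟩ ⟨a1, a2, a3, a4, a5⟩; exact mem a2 a3 a4 a5
  have sub2 : Cyl (-1) (R ^ 2) (T / 2) t₀ ⊆ Cyl (-1) (4 * R ^ 2) (T / 2) t₀ := by
    rintro ⟨x, y, t⟩ ⟨a1, a2, a3, a4, a5⟩; exact mem (by simp only at a2; linarith) a3 a4 a5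
  have habs : ∀ {a b : ℝ}, |a - b| ≤ 1 → |a| ≤ |b| + 1 := fun {a b} hab => by
    have := abs_sub_abs_le_abs_sub a b; linarith
  -- gradient on annulus
  have annG : ∀ x y t, R ^ 2 / 4 ≤ x ^ 2 + y ^ 2 → x ^ 2 + y ^ 2 ≤ 4 * R ^ 2 → T / 2 ≤ t → t ≤ t₀ →
      ∀ x' y' t', |x' - x| ≤ h → |y' - y| ≤ h → 0 ≤ y' → |t' - t| ≤ h → gradNorm u x' y' t' ≤ G := by
    intro x y t a1 a2 a3 a4 x' y' t' b1 b2 b3 b4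
    have hs := shift_bds hR l1 b1 b2 a2
    have := abs_le.1 b4
    exact hG x' y' t' (by linarith [hs.2]) hs.1 b3 (by linarith) (by linarith)
  have z0 : |(0:ℝ)| ≤ h := by simpa using hpos.le
  have zh : |h| ≤ h := by rw [abs_of_pos hpos]
  have hb := hC t₀ (W h) (fun x y t => 0 + h⁻¹ * (u (x + h * 1) (y + h * 0) (t + h * 0) - u x y t))
    (fun x y t => 0 + h⁻¹ * (u (x + h * 0) (y + h * 1) (t + h * 0) - u x y t)) k4.le
    (w1.mono sub1)
    (by
      have A := shift_cont hL hsol (t0 := T / 2) (t1 := t₀) (a := h * 1) (b := h * 0) (c := h * 0) (by linarith) k4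
        (by rw [mul_one, abs_of_pos hpos]; exact l1) (by simp) (by simp; positivity) (by simp; linarith) (by simp; linarith)
      have A0 := shift_cont hL hsol (t0 := T / 2) (t1 := t₀) (a := 0) (b := 0) (c := 0) (by linarith) k4
        (by simp; positivity) (by simp) (by simp; positivity) (by simp; linarith) (by simp; linarith)
      simp only [add_zero] at A0
      exact (continuousOn_const.add (continuousOn_const.mul (A.sub A0))).mono sub1)
    (by
      have A := shift_cont hL hsol (t0 := T / 2) (t1 := t₀) (a := h * 0) (b := h * 1) (c := h * 0) (by linarith) k4
        (by simp; positivity) (by simp; linarith) (by rw [mul_one, abs_of_pos hpos]; exact l1) (by simp; linarith) (by simp; linarith)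
      have A0 := shift_cont hL hsol (t0 := T / 2) (t1 := t₀) (a := 0) (b := 0) (c := 0) (by linarith) k4
        (by simp; positivity) (by simp) (by simp; positivity) (by simp; linarith) (by simp; linarith)
      simp only [add_zero] at A0
      exact (continuousOn_const.add (continuousOn_const.mul (A.sub A0))).mono sub1)
    (by
      intro x y t a1 a2 a3 a4 a5
      have gg := annG x y t a1.le a2.le a4.le a5
      have g0 := gg x y t (by simpa using z0) (by simpa using z0) a3.le (by simpa using z0)
      have hd := dom_lt hL (x := x) (y := y) (by rw [← hRdef]; linarith)
      have s1 := shift_bds (x' := x + h * 1) (y' := y + h * 0) hR l1 (by simpa using zh) (by simpa using z0) a2.le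
      have s2 := shift_bds (x' := x + h * 0) (y' := y + h * 1) hR l1 (by simpa using z0) (by simpa using zh) a2.le
      have hd1 := dom_lt hL s1.1
      have hd2 := dom_lt hL s2.1
      have T1 := diff_two hp hsol (a := h * 1) (b := h * 0) (c := h * 0) 0 h⁻¹ hd.1 ⟨a3, hd.2⟩
        (show t ∈ Ioo 0 T from ⟨by linarith, by linarith⟩) hd1.1 ⟨by simpa using a3, hd1.2⟩
        ⟨by simp; linarith, by simp; linarith⟩ g0
        (gg _ _ _ (by simpa using zh) (by simpa using z0) (by simpa using a3.le) (by simpa using z0))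
      have T2 := diff_two hp hsol (a := h * 0) (b := h * 1) (c := h * 0) 0 h⁻¹ hd.1 ⟨a3, hd.2⟩
        (show t ∈ Ioo 0 T from ⟨by linarith, by linarith⟩) hd2.1 ⟨by simp; linarith, hd2.2⟩
        ⟨by simp; linarith, by simp; linarith⟩ g0
        (gg _ _ _ (by simpa using z0) (by simpa using zh) (by simp; linarith) (by simpa using z0))
      refine ⟨w3 x y t G a2.le a3 a4.le a5 gg, _, _, _, _, T1, T2, ?_⟩
      obtain ⟨-, -, -, q1, q2⟩ := h2 x y t (mem a2.le a3.le a4.le a5)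
      have q3 := w2 x y t (mem a2.le a3.le a4.le a5)
      have q4 := hW0 x y t a1 a2 a3 a4 (by linarith)
      rw [abs_sub_comm] at q1 q2
      have r1 := habs q1
      have r2 := habs q2
      have r3 := habs q3
      generalize h⁻¹ * (pdx u (x + h * 1) (y + h * 0) (t + h * 0) - pdx u x y t) = dx at *
      generalize h⁻¹ * (pdy u (x + h * 0) (y + h * 1) (t + h * 0) - pdy u x y t) = ey at *
      have r4 : |W h x y t| ≤ |dx| + |ey| + (C0 + 3) := by linarith
      rw [← sq_abs (W h x y t), ← sq_abs dx, ← sq_abs ey]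
      nlinarith [abs_nonneg (W h x y t), abs_nonneg dx, abs_nonneg ey, sq_nonneg (|dx| - |ey|),
        sq_nonneg (|dx| - (C0 + 3)), sq_nonneg (|ey| - (C0 + 3)), sq_nonneg (|dx|), sq_nonneg (|ey|)])
    (by
      intro x y t a1 a2 a3 a4 a5
      have g0 := annG x y t a1 a2 a4 a5 x y t (by simpa using z0) (by simpa using z0) a3 (by simpa using z0)
      obtain ⟨q1, q2, -⟩ := h2 x y t (mem a2 a3 a4 a5)
      have r1 := habs q1
      have r2 := habs q2
      have := pdx_le u x y t
      have := pdy_le u x y t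
      simp only [zero_add]
      exact ⟨sq_le_sq.2 (by rw [abs_of_nonneg (show 0 ≤ G + 1 by linarith)]; linarith),
        sq_le_sq.2 (by rw [abs_of_nonneg (show 0 ≤ G + 1 by linarith)]; linarith)⟩)
    w4
    (by
      intro x y a1 a2
      have r := habs (w2 x y (T / 2) (mem a1 a2 le_rfl k3))
      have := hini x y a1 a2
      exact sq_le_sq.2 (by rw [abs_of_nonneg (show 0 ≤ N + 1 by linarith)]; linarith))
  obtain ⟨G', hG'0, hG'⟩ := disc_bound hL hsol (a := T / 4) (b := (T + t₀) / 2) (by positivity) (by linarith)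
  have key := min_disc (R ^ 2) (T / 2) t₀ (p * G' ^ (p - 1)) D (W h) (w1.mono sub2)
    (by
      intro x y t a1 a2 a3 a4
      refine w3 x y t G' (by linarith) a2 a3.le a4 fun x' y' t' b1 b2 b3 b4 => ?_
      have hs := shift_bds hR l1 b1 b2 (show x ^ 2 + y ^ 2 ≤ 4 * R ^ 2 by linarith)
      have := abs_le.1 b4
      exact hG' x' y' t' hs.1 b3 (by linarith) (by linarith))
    (by
      intro x y a1 a2 _
      have r := habs (w2 x y (T / 2) (mem (by linarith) a2 le_rfl k3))
      have := hini x y (by linarith) a2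
      have := neg_abs_le (W h x y (T / 2))
      linarith)
    (by
      intro x y t a1 a2 a3 a4
      by_contra! hlt
      have h3 := hb x y t (by linarith) (by linarith) a2 a3 a4 (by linarith)
      have hc : cut R x y = K := by rw [hK, cut, a1]; ring
      rw [hc] at h3
      have h4 := Real.abs_le_sqrt h3
      have h5 : -(K * W h x y t) ≤ Real.sqrt C := (neg_le_abs _).trans h4
      have h6 : -W h x y t ≤ Real.sqrt C / K := by rw [le_div_iff₀ hKp]; linarith
      linarith)
    (by
      intro x t a1 a2 a3
      have := w4 x t (by linarith) a2 a3
      linarith)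
  have f1 := key x₀ y₀ t₀ k1 k2 k3 le_rfl
  have f2 := abs_le.1 (w2 x₀ y₀ t₀ (mem (by linarith) k2 k3 le_rfl))
  linarith
end main5


section main6
variable {p L T : ℝ} {u : ℝ → ℝ → ℝ → ℝ}

lemma ini_bound (F : ℝ → ℝ → ℝ → ℝ) (r τ : ℝ)
    (hF : ∀ x y, x ^ 2 + y ^ 2 ≤ r → 0 ≤ y → ContinuousAt (fun q : ℝ × ℝ × ℝ => F q.1 q.2.1 q.2.2) (x, y, τ)) :
    ∃ N : ℝ, ∀ x y, x ^ 2 + y ^ 2 ≤ r → 0 ≤ y → |F x y τ| ≤ N := by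
  obtain ⟨C, hC⟩ := (cyl_compact (-1) r τ τ).exists_bound_of_continuousOn
    (f := fun q : ℝ × ℝ × ℝ => F q.1 q.2.1 q.2.2) (by
      rintro ⟨x, y, t⟩ ⟨h1, h2, h3, h4, h5⟩
      simp only at h1 h2 h3 h4 h5
      obtain rfl : t = τ := le_antisymm h5 h4
      exact (hF x y h2 h3).continuousWithinAt)
  exact ⟨C, fun x y h1 h2 => hC (x, y, τ) ⟨by simp only; nlinarith [sq_nonneg x, sq_nonneg y], h1, h2, le_rfl, le_rfl⟩⟩

set_option maxHeartbeats 1000000 in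
lemma quot_low (hp : 2 < p) (hL : 0 < L) (hT : 0 < T) (hsol : ClassicalSolution p L T u)
    (hgbu : IsolatedGBU L T u) (F : ℝ → ℝ → ℝ → ℝ) (a b c k σ C1 : ℝ)
    (ha0 : 0 ≤ a) (ha : a ≤ 1) (hb0 : 0 ≤ b) (hb : b ≤ 1) (hc0 : 0 ≤ c) (hc : c ≤ 1) (hσ : |σ| ≤ 1) (hC1 : 0 ≤ C1)
    (hF : ∀ x y, x ^ 2 + y ^ 2 ≤ 4 * (L / 4) ^ 2 → 0 ≤ y → ContinuousAt (fun q : ℝ × ℝ × ℝ => F q.1 q.2.1 q.2.2) (x, y, T / 2))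
    (hcl : ∀ T', T' < T → ∀ᶠ h in nhdsWithin (0:ℝ) (Ioi 0), ∀ x y t, (x, y, t) ∈ Cyl (-1) (4 * (L / 4) ^ 2) (T / 2) T' →
      |(h⁻¹ * (u (x + h * a) (y + h * b) (t + h * c) - u x y t)) - F x y t| ≤ 1)
    (hbot : ∀ T', T / 2 ≤ T' → T' < T → ∀ᶠ h in nhdsWithin (0:ℝ) (Ioi 0), ∀ x t, x ^ 2 ≤ 4 * (L / 4) ^ 2 → T / 2 ≤ t → t ≤ T' →
      0 ≤ k + (σ * h⁻¹) * (u (x + h * a) (0 + h * b) (t + h * c) - u x 0 t))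
    (hW0 : ∀ x y t, (L / 4) ^ 2 / 4 < x ^ 2 + y ^ 2 → x ^ 2 + y ^ 2 < 4 * (L / 4) ^ 2 → 0 < y → T / 2 < t → t < T →
      |F x y t| ≤ |pdxx u x y t| + |pdyy u x y t| + C1) :
    ∃ C, 0 ≤ C ∧ ∀ x y t, x ^ 2 + y ^ 2 ≤ (L / 4) ^ 2 → 0 ≤ y → T / 2 ≤ t → t < T → -C ≤ k + σ * F x y t := by
  obtain ⟨N, hN⟩ := ini_bound F _ _ hF
  have hkF : ∀ z : ℝ, |k + σ * z| ≤ |k| + |z| := fun z => by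
    refine (abs_add_le _ _).trans ?_
    rw [abs_mul]; nlinarith [abs_nonneg z, abs_nonneg σ]
  refine main_low hp hL hT hsol hgbu
    (fun h x y t => k + (σ * h⁻¹) * (u (x + h * a) (y + h * b) (t + h * c) - u x y t))
    (fun x y t => k + σ * F x y t) (|k| + C1) (|k| + N) (by positivity) ?_ ?_ ?_
  · intro T' hT1 hT2
    have hm : 0 < min (L / 4 / 64) (min ((T - T') / 2) (T / 4)) :=
      lt_min (by positivity) (lt_min (by linarith) (by positivity))
    filter_upwards [hcl T' hT2, hbot T' hT1 hT2, ev_small hm] with h h1 h2 ⟨hpos, hle⟩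
    have l1 := hle.trans (min_le_left _ _)
    have l2 := (hle.trans (min_le_right _ _)).trans (min_le_left _ _)
    have l3 := (hle.trans (min_le_right _ _)).trans (min_le_right _ _)
    have A0 : 0 ≤ h * a := by positivity
    have A1 : h * a ≤ h := by nlinarith
    have B0 : 0 ≤ h * b := by positivity
    have B1 : h * b ≤ h := by nlinarith
    have D0 : 0 ≤ h * c := by positivity
    have D1 : h * c ≤ h := by nlinarith
    refine ⟨?_, ?_, ?_, h2⟩
    · have A := shift_cont hL hsol (t0 := T / 2) (t1 := T') (a := h * a) (b := h * b) (c := h * c) (by linarith) hT2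
        (by rw [abs_of_nonneg A0]; linarith) B0 (by rw [abs_of_nonneg B0]; linarith) (by linarith) (by linarith)
      have A0 := shift_cont hL hsol (t0 := T / 2) (t1 := T') (a := 0) (b := 0) (c := 0) (by linarith) hT2
        (by simp; positivity) (by simp) (by simp; positivity) (by simp; linarith) (by simp; linarith)
      simp only [add_zero] at A0
      exact (continuousOn_const.add (continuousOn_const.mul (A.sub A0)))
    · intro x y t hm
      have := h1 x y t hm
      have e : (k + σ * h⁻¹ * (u (x + h * a) (y + h * b) (t + h * c) - u x y t)) - (k + σ * F x y t)
        = σ * (h⁻¹ * (u (x + h * a) (y + h * b) (t + h * c) - u x y t) - F x y t) := by ring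
      rw [e, abs_mul]
      nlinarith [abs_nonneg σ, abs_nonneg (h⁻¹ * (u (x + h * a) (y + h * b) (t + h * c) - u x y t) - F x y t)]
    · intro x y t G a1 a2 a3 a4 hG
      have z0 : |(0:ℝ)| ≤ h := by simpa using hpos.le
      have hd := dom_lt hL (x := x) (y := y) (by nlinarith [sq_nonneg L])
      have s1 := shift_bds (x' := x + h * a) (y' := y + h * b) (R := L / 4) (by positivity) l1
        (by rw [add_sub_cancel_left, abs_of_nonneg A0]; exact A1) (by rw [add_sub_cancel_left, abs_of_nonneg B0]; exact B1) a1
      have hd1 := dom_lt hL s1.1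
      exact (diff_two hp hsol (a := h * a) (b := h * b) (c := h * c) k (σ * h⁻¹) hd.1 ⟨a2, hd.2⟩
        (show t ∈ Ioo 0 T from ⟨by linarith, by linarith⟩) hd1.1 ⟨by linarith, hd1.2⟩
        ⟨by linarith, by linarith⟩ (hG x y t (by simpa using z0) (by simpa using z0) a2.le (by simpa using z0))
        (hG _ _ _ (by rw [add_sub_cancel_left, abs_of_nonneg A0]; exact A1)
          (by rw [add_sub_cancel_left, abs_of_nonneg B0]; exact B1) (by linarith)
          (by rw [add_sub_cancel_left, abs_of_nonneg D0]; exact D1))).spr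
  · intro x y t a1 a2 a3 a4 a5
    have := hkF (F x y t)
    have := hW0 x y t a1 a2 a3 a4 a5
    linarith
  · intro x y a1 a2
    have := hkF (F x y (T / 2))
    have := hN x y a1 a2
    linarith

/-- the half disc -/
def Reg (L T x y t : ℝ) : Prop := x ^ 2 + y ^ 2 ≤ (L / 4) ^ 2 ∧ 0 ≤ y ∧ T / 2 ≤ t ∧ t < T

lemma grad_ann (hL : 0 < L) (hT : 0 < T) (hgbu : IsolatedGBU L T u) : ∃ G : ℝ, 0 ≤ G ∧ ∀ x y t,
    (L / 4) ^ 2 / 4 < x ^ 2 + y ^ 2 → x ^ 2 + y ^ 2 < 4 * (L / 4) ^ 2 → 0 < y → T / 2 < t → t < T →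
    gradNorm u x y t ≤ G := by
  obtain ⟨G, hG0, hG⟩ := ann_bound hL hgbu
  have : 0 < L ^ 2 := by positivity
  exact ⟨G, hG0, fun x y t a1 a2 a3 a4 a5 => hG x y t (by nlinarith) (by nlinarith) a3.le (by linarith) a5⟩

lemma smT (hL : 0 < L) (hT : 0 < T) (hsol : ClassicalSolution p L T u) {x y t : ℝ}
    (h : x ^ 2 + y ^ 2 ≤ 4 * (L / 4) ^ 2) (hy : 0 ≤ y) (h0 : T / 2 ≤ t) (h1 : t < T) : C21At u x y t :=
  sm hL hsol (by nlinarith [sq_nonneg L]) hy (by linarith) h1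

lemma bc0 (hL : 0 < L) (hsol : ClassicalSolution p L T u) {x h t : ℝ} (hx : x ^ 2 ≤ 4 * (L / 4) ^ 2) (hh : |h| ≤ L / 4 / 64)
    (h0 : 0 < t) (h1 : t < T) : u (x + h) 0 t = 0 := by
  have := shift_bds (x := x) (y := 0) (x' := x + h) (y' := 0) (R := L / 4) (h := L / 4 / 64) (by positivity) le_rfl (by simpa using hh)
    (by simp; positivity) (by simpa using hx)
  exact hsol.bc (dom_lt hL this.1).1 ⟨h0, h1⟩

lemma ux_low (hp : 2 < p) (hL : 0 < L) (hT : 0 < T) (hsol : ClassicalSolution p L T u)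
    (hgbu : IsolatedGBU L T u) (σ : ℝ) (hσ : |σ| ≤ 1) : ∃ C, 0 ≤ C ∧ ∀ x y t, x ^ 2 + y ^ 2 ≤ (L / 4) ^ 2 → 0 ≤ y → T / 2 ≤ t → t < T →
      -C ≤ 0 + σ * pdx u x y t := by
  obtain ⟨G, hG0, hG⟩ := grad_ann hL hT hgbu
  refine quot_low hp hL hT hsol hgbu (pdx u) 1 0 0 0 σ G zero_le_one le_rfl le_rfl zero_le_one le_rfl zero_le_one hσ hG0
    ?_ ?_ ?_ ?_
  · intro x y a b
    obtain ⟨-, -, -, -, -, -, c0, c1, c2, c3, c4, c5, c6⟩ := smT hL hT hsol a b le_rfl (by linarith)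
    exact c1
  · intro T' hT'
    filter_upwards [close_all hL hT hsol hT'] with h hh x y t hm
    exact (hh x y t hm).1
  · intro T' hT1 hT2
    have hm : 0 < L / 4 / 64 := by positivity
    filter_upwards [ev_small hm] with h ⟨hpos, hle⟩ x t a1 a2 a3
    have e1 := bc0 hL hsol a1 (h := h) (t := t) (by rwa [abs_of_pos hpos]) (by linarith) (by linarith)
    have e2 := bc0 hL hsol a1 (h := 0) (t := t) (by simpa using hm.le) (by linarith) (by linarith)
    rw [add_zero] at e2
    simp [e1, e2]
  · intro x y t a1 a2 a3 a4 a5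
    have := hG x y t a1 a2 a3 a4 a5
    have := pdx_le u x y t
    have := abs_nonneg (pdxx u x y t)
    have := abs_nonneg (pdyy u x y t)
    linarith

lemma ut_low (hp : 2 < p) (hL : 0 < L) (hT : 0 < T) (hsol : ClassicalSolution p L T u)
    (hgbu : IsolatedGBU L T u) (σ : ℝ) (hσ : |σ| ≤ 1) : ∃ C, 0 ≤ C ∧ ∀ x y t, x ^ 2 + y ^ 2 ≤ (L / 4) ^ 2 → 0 ≤ y → T / 2 ≤ t → t < T →
      -C ≤ 0 + σ * pdt u x y t := by
  obtain ⟨G, hG0, hG⟩ := grad_ann hL hT hgbu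
  refine quot_low hp hL hT hsol hgbu (pdt u) 0 0 1 0 σ (G ^ p) le_rfl zero_le_one le_rfl zero_le_one zero_le_one le_rfl hσ (by positivity)
    ?_ ?_ ?_ ?_
  · intro x y a b
    obtain ⟨-, -, -, -, -, -, c0, c1, c2, c3, c4, c5, c6⟩ := smT hL hT hsol a b le_rfl (by linarith)
    exact c3
  · intro T' hT'
    filter_upwards [close_all hL hT hsol hT'] with h hh x y t hm
    exact (hh x y t hm).2.2.1
  · intro T' hT1 hT2
    have hm : 0 < (T - T') / 2 := by linarith
    filter_upwards [ev_small hm] with h ⟨hpos, hle⟩ x t a1 a2 a3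
    have hz : |(0:ℝ)| ≤ L / 4 / 64 := by simp; positivity
    have e1 := bc0 hL hsol a1 (h := 0) (t := t + h) hz (by linarith) (by linarith)
    have e2 := bc0 hL hsol a1 (h := 0) (t := t) hz (by linarith) (by linarith)
    rw [add_zero] at e1 e2
    simp [e1, e2]
  · intro x y t a1 a2 a3 a4 a5
    have h1 := hG x y t a1 a2 a3 a4 a5
    have hd := dom_lt hL (x := x) (y := y) (by nlinarith [sq_nonneg L])
    have h2 := hsol.pde hd.1 ⟨a3, hd.2⟩ ⟨by linarith, a5⟩
    have h3 : gradNorm u x y t ^ p ≤ G ^ p := Real.rpow_le_rpow (grad_nonneg u x y t) h1 (by linarith)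
    have h4 : 0 ≤ gradNorm u x y t ^ p := Real.rpow_nonneg (grad_nonneg u x y t) _
    have e : pdt u x y t = pdxx u x y t + pdyy u x y t + gradNorm u x y t ^ p := by linarith
    rw [e]
    refine (abs_add_le _ _).trans ?_
    have := abs_add_le (pdxx u x y t) (pdyy u x y t)
    rw [abs_of_nonneg h4]; linarith

lemma uy_low (hp : 2 < p) (hL : 0 < L) (hT : 0 < T) (hsol : ClassicalSolution p L T u)
    (hgbu : IsolatedGBU L T u) (k σ : ℝ) (hσ : |σ| ≤ 1)
    (hbot : ∀ T', T / 2 ≤ T' → T' < T → ∀ᶠ h in nhdsWithin (0:ℝ) (Ioi 0), ∀ x t, x ^ 2 ≤ 4 * (L / 4) ^ 2 → T / 2 ≤ t → t ≤ T' →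
      0 ≤ k + (σ * h⁻¹) * (u x h t)) :
    ∃ C, 0 ≤ C ∧ ∀ x y t, x ^ 2 + y ^ 2 ≤ (L / 4) ^ 2 → 0 ≤ y → T / 2 ≤ t → t < T →
      -C ≤ k + σ * pdy u x y t := by
  obtain ⟨G, hG0, hG⟩ := grad_ann hL hT hgbu
  refine quot_low hp hL hT hsol hgbu (pdy u) 0 1 0 k σ G le_rfl zero_le_one zero_le_one le_rfl le_rfl zero_le_one hσ hG0
    ?_ ?_ ?_ ?_
  · intro x y a b
    obtain ⟨-, -, -, -, -, -, c0, c1, c2, c3, c4, c5, c6⟩ := smT hL hT hsol a b le_rfl (by linarith)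
    exact c2
  · intro T' hT'
    filter_upwards [close_all hL hT hsol hT'] with h hh x y t hm
    exact (hh x y t hm).2.1
  · intro T' hT1 hT2
    filter_upwards [hbot T' hT1 hT2] with h hh x t a1 a2 a3
    have hz : |(0:ℝ)| ≤ L / 4 / 64 := by simp; positivity
    have e2 := bc0 hL hsol a1 (h := 0) (t := t) hz (by linarith) (by linarith)
    rw [add_zero] at e2
    have := hh x t a1 a2 a3
    simpa [e2] using this
  · intro x y t a1 a2 a3 a4 a5
    have := hG x y t a1 a2 a3 a4 a5
    have := pdy_le u x y t
    have := abs_nonneg (pdxx u x y t)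
    have := abs_nonneg (pdyy u x y t)
    linarith
end main6


lemma second_mvt {f f' f'' : ℝ → ℝ} {x h : ℝ} (hh : 0 < h)
    (h1 : ∀ s ∈ Icc (x - h) (x + h), HasDerivAt f (f' s) s)
    (h2 : ∀ s ∈ Icc (x - h) (x + h), HasDerivAt f' (f'' s) s) :
    ∃ ξ, |ξ - x| ≤ h ∧ f (x + h) + f (x + -h) - 2 * f x = h ^ 2 * f'' ξ := by
  have hd : ∀ s ∈ Icc 0 h, HasDerivAt (fun s => f (x + s) + f (x + -s)) (f' (x + s) - f' (x + -s)) s := by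
    intro s hs
    have a1 := (h1 (x + s) ⟨by linarith [hs.1], by linarith [hs.2]⟩).comp_const_add x s
    have a2 := (h1 (x + -s) ⟨by linarith [hs.2], by linarith [hs.1]⟩).comp_const_add x (-s)
    have a3 := a2.comp s (hasDerivAt_neg s)
    have := a1.add a3
    exact this.congr_deriv (by ring)
  obtain ⟨c, hc, e⟩ := exists_ratio_hasDerivAt_eq_ratio_slope (fun s => f (x + s) + f (x + -s))
    (fun s => f' (x + s) - f' (x + -s)) hh
    (fun s hs => (hd s hs).continuousAt.continuousWithinAt)
    (fun s hs => hd s ⟨hs.1.le, hs.2.le⟩) (fun s => s ^ 2) (fun s => 2 * s) (by fun_prop)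
    (fun s _ => by simpa using hasDerivAt_pow 2 s)
  have hlt : x + -c < x + c := by linarith [hc.1]
  obtain ⟨ξ, hξ, e2⟩ := exists_hasDerivAt_eq_slope f' f'' hlt
    (fun s hs => (h2 s ⟨by linarith [hs.1, hc.2], by linarith [hs.2, hc.2]⟩).continuousAt.continuousWithinAt)
    (fun s hs => h2 s ⟨by linarith [hs.1, hc.2], by linarith [hs.2, hc.2]⟩)
  refine ⟨ξ, abs_le.2 ⟨by linarith [hξ.1, hc.2], by linarith [hξ.2, hc.2]⟩, ?_⟩
  have hc0 := hc.1
  rw [eq_div_iff (by linarith)] at e2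
  rw [← e2] at e
  simp only [neg_zero, add_zero] at e
  have : 2 * c ≠ 0 := by linarith
  apply mul_right_cancel₀ this
  linarith

section main7
variable {p L T : ℝ} {u : ℝ → ℝ → ℝ → ℝ}

set_option maxHeartbeats 1000000 in
lemma uxx_low (hp : 2 < p) (hL : 0 < L) (hT : 0 < T) (hsol : ClassicalSolution p L T u)
    (hgbu : IsolatedGBU L T u) :
    ∃ C, 0 ≤ C ∧ ∀ x y t, x ^ 2 + y ^ 2 ≤ (L / 4) ^ 2 → 0 ≤ y → T / 2 ≤ t → t < T → -C ≤ pdxx u x y t := by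
  obtain ⟨N, hN⟩ := ini_bound (pdxx u) (4 * (L / 4) ^ 2) (T / 2) (by
    intro x y a b
    obtain ⟨-, -, -, -, -, -, c0, c1, c2, c3, c4, c5, c6⟩ := smT hL hT hsol a b le_rfl (by linarith)
    exact c4)
  refine main_low hp hL hT hsol hgbu
    (fun h x y t => (h ^ 2)⁻¹ * (u (x + h) y t + u (x + -h) y t - 2 * u x y t))
    (pdxx u) 0 N le_rfl ?_ ?_ hN
  · intro T' hT1 hT2
    obtain ⟨d, hd0, hd⟩ := unif_cont (F := fun q : ℝ × ℝ × ℝ => pdxx u q.1 q.2.1 q.2.2)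
      (cyl_compact (-1) (4 * (L / 4) ^ 2) (T / 2) T') (by
        rintro ⟨x, y, t⟩ ⟨a1, a2, a3, a4, a5⟩
        simp only at a1 a2 a3 a4 a5
        obtain ⟨-, -, -, -, -, -, c0, c1, c2, c3, c4, c5, c6⟩ := smT hL hT hsol a2 a3 a4 (by linarith)
        exact c4) zero_lt_one
    have hm : 0 < min (L / 4 / 64) (d / 2) := lt_min (by positivity) (by linarith)
    filter_upwards [ev_small hm] with h ⟨hpos, hle⟩
    have l1 := hle.trans (min_le_left _ _)
    have l2 := hle.trans (min_le_right _ _)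
    have zz : |(0:ℝ)| ≤ L / 4 / 64 := by simp; positivity
    have p1 : |h| ≤ L / 4 / 64 := by rwa [abs_of_pos hpos]
    have p2 : |(-h)| ≤ L / 4 / 64 := by rwa [abs_neg]
    have sh : ∀ x y ξ, x ^ 2 + y ^ 2 ≤ 4 * (L / 4) ^ 2 → |ξ - x| ≤ h → ξ ^ 2 + y ^ 2 ≤ 9 * (L / 4) ^ 2 := by
      intro x y ξ a1 a2
      exact (shift_bds (y' := y) (R := L / 4) (by positivity) l1 a2 (by simpa using hpos.le) a1).1
    refine ⟨?_, ?_, ?_, ?_⟩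
    · have A1 := shift_cont hL hsol (t0 := T / 2) (t1 := T') (a := h) (b := 0) (c := 0) (by linarith) hT2
        p1 le_rfl zz (by linarith) (by linarith)
      have A2 := shift_cont hL hsol (t0 := T / 2) (t1 := T') (a := -h) (b := 0) (c := 0) (by linarith) hT2
        p2 le_rfl zz (by linarith) (by linarith)
      have A0 := shift_cont hL hsol (t0 := T / 2) (t1 := T') (a := 0) (b := 0) (c := 0) (by linarith) hT2
        zz le_rfl zz (by linarith) (by linarith)
      simp only [add_zero] at A0 A1 A2
      exact continuousOn_const.mul ((A1.add A2).sub (continuousOn_const.mul A0))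
    · intro x y t hq
      obtain ⟨a1, a2, a3, a4, a5⟩ := id hq
      simp only at a1 a2 a3 a4 a5
      have hS : ∀ s ∈ Icc (x - h) (x + h), C21At u s y t := fun s hs =>
        sm hL hsol (sh x y s a2 (abs_le.2 ⟨by linarith [hs.1], by linarith [hs.2]⟩)) a3 (by linarith) (by linarith)
      obtain ⟨ξ, hξ, e⟩ := second_mvt (f := fun s => u s y t) (f' := fun s => pdx u s y t)
        (f'' := fun s => pdxx u s y t) (x := x) hpos
        (fun s hs => (hS s hs).1.hasDerivAt) (fun s hs => (hS s hs).2.2.2.1.hasDerivAt)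
      have hh2 : h ^ 2 ≠ 0 := by positivity
      rw [e, inv_mul_cancel_left₀ hh2]
      have := hd (x, y, t) hq (ξ, y, t) (by
        rw [dist_comm]
        simp only [Prod.dist_eq, dist_self, Real.dist_eq]
        exact max_lt (by linarith) (by simpa using hd0))
      exact this.le
    · intro x y t G a1 a2 a3 a4 hG
      have hd := dom_lt hL (sh x y x a1 (by simpa using hpos.le))
      have hd1 := dom_lt hL (sh x y (x + h) a1 (by rw [add_sub_cancel_left, abs_of_pos hpos]))
      have hd2 := dom_lt hL (sh x y (x + -h) a1 (by rw [add_sub_cancel_left, abs_neg, abs_of_pos hpos]))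
      have z0 : |(0:ℝ)| ≤ h := by simpa using hpos.le
      exact diff_second hp hsol hpos hd.1 ⟨a2, hd.2⟩ ⟨by linarith, by linarith⟩ hd1.1 hd2.1
        (hG x y t (by simpa using z0) (by simpa using z0) a2.le (by simpa using z0))
        (hG _ _ _ (by rw [add_sub_cancel_left, abs_of_pos hpos]) (by simpa using z0) a2.le (by simpa using z0))
        (hG _ _ _ (by rw [add_sub_cancel_left, abs_neg, abs_of_pos hpos]) (by simpa using z0) a2.le (by simpa using z0))
    · intro x t a1 a2 a3
      have e1 := bc0 hL hsol a1 (h := h) (t := t) p1 (by linarith) (by linarith)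
      have e3 := bc0 hL hsol a1 (h := -h) (t := t) p2 (by linarith) (by linarith)
      have e2 := bc0 hL hsol a1 (h := 0) (t := t) zz (by linarith) (by linarith)
      rw [add_zero] at e2
      simp only [e1, e2, e3]; simp
  · intro x y t a1 a2 a3 a4 a5
    have := abs_nonneg (pdyy u x y t)
    linarith

/-- all bounds with a single constant -/
lemma all_bounds (hp : 2 < p) (hL : 0 < L) (hT : 0 < T) (hsol : ClassicalSolution p L T u)
    (hgbu : IsolatedGBU L T u) :
    ∃ C, 0 ≤ C ∧ ∀ x y t, Reg L T x y t → |pdx u x y t| ≤ C ∧ |pdt u x y t| ≤ C ∧ -C ≤ pdxx u x y t ∧ -C ≤ pdy u x y t := by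
  obtain ⟨C1, h1, k1⟩ := ux_low hp hL hT hsol hgbu 1 (by simp)
  obtain ⟨C2, h2, k2⟩ := ux_low hp hL hT hsol hgbu (-1) (by simp)
  obtain ⟨C3, h3, k3⟩ := ut_low hp hL hT hsol hgbu 1 (by simp)
  obtain ⟨C4, h4, k4⟩ := ut_low hp hL hT hsol hgbu (-1) (by simp)
  obtain ⟨C5, h5, k5⟩ := uxx_low hp hL hT hsol hgbu
  obtain ⟨C6, h6, k6⟩ := uy_low hp hL hT hsol hgbu 0 1 (by simp) (by
    intro T' hT1 hT2
    have hm : 0 < L := hL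
    filter_upwards [ev_small hm] with h ⟨hpos, hle⟩ x t a1 a2 a3
    have := hsol.nonneg (x := x) (y := h) (t := t) (dom_lt hL (x := x) (y := 0) (by nlinarith [sq_nonneg L])).1.le
      ⟨hpos.le, hle⟩ ⟨by linarith, by linarith⟩
    have : 0 ≤ h⁻¹ * u x h t := mul_nonneg (by positivity) this
    linarith)
  refine ⟨C1 + C2 + C3 + C4 + C5 + C6, by positivity, fun x y t ⟨a, b, c, d⟩ => ?_⟩
  have := k1 x y t a b c d
  have := k2 x y t a b c d
  have := k3 x y t a b c d
  have := k4 x y t a b c d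
  have := k5 x y t a b c d
  have := k6 x y t a b c d
  exact ⟨abs_le.2 ⟨by linarith, by linarith⟩, abs_le.2 ⟨by linarith, by linarith⟩, by linarith, by linarith⟩
end main7


section main8
variable {p L T : ℝ} {u : ℝ → ℝ → ℝ → ℝ}

lemma mono_x (hsol : ClassicalSolution p L T u) (hmon : MonCond L T u) {x y t : ℝ} (hx : |x| < L)
    (hy : y ∈ Ioo (0:ℝ) L) (ht : t ∈ Ioo 0 T) : u x y t ≤ u 0 y t := by
  have hd : ∀ s, |s| < L → DifferentiableAt ℝ (fun s => u s y t) s := fun s hs =>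
    (hsol.smooth hs.le ⟨hy.1.le, hy.2.le⟩ ht).1
  have hx' := abs_lt.1 hx
  rcases le_total 0 x with h | h
  · have hs : ∀ s ∈ Icc 0 x, |s| < L := fun s hs => abs_lt.2 ⟨by linarith [hs.1, hs.2], by linarith [hs.2]⟩
    have := antitoneOn_of_deriv_nonpos (convex_Icc 0 x) (f := fun s => u s y t)
      (fun s h => (hd s (hs s h)).continuousAt.continuousWithinAt)
      (fun s h => (hd s (hs s (interior_subset h))).differentiableWithinAt)
      (fun s h => by
        rw [interior_Icc] at h
        have h1 : s * pdx u s y t ≤ 0 := hmon (hs s ⟨h.1.le, h.2.le⟩) hy ht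
        have h2 : pdx u s y t ≤ 0 := by by_contra! hc; nlinarith [mul_pos h.1 hc]
        exact h2)
    exact this ⟨le_rfl, h⟩ ⟨h, le_rfl⟩ h
  · have hs : ∀ s ∈ Icc x 0, |s| < L := fun s hs => abs_lt.2 ⟨by linarith [hs.1, hs.2], by linarith [hs.2]⟩
    have := monotoneOn_of_deriv_nonneg (convex_Icc x 0) (f := fun s => u s y t)
      (fun s h => (hd s (hs s h)).continuousAt.continuousWithinAt)
      (fun s h => (hd s (hs s (interior_subset h))).differentiableWithinAt)
      (fun s h => by
        rw [interior_Icc] at h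
        have h1 : s * pdx u s y t ≤ 0 := hmon (hs s ⟨h.1.le, h.2.le⟩) hy ht
        have h2 : 0 ≤ pdx u s y t := by by_contra! hc; nlinarith [mul_pos_of_neg_of_neg h.2 hc]
        exact h2)
    exact this ⟨le_rfl, h⟩ ⟨h, le_rfl⟩ h

lemma axis (hL : 0 < L) (hsol : ClassicalSolution p L T u) (hmon : MonCond L T u) {y t : ℝ}
    (hy : y ∈ Ioo (0:ℝ) L) (ht : t ∈ Ioo 0 T) : pdx u 0 y t = 0 ∧ pdxx u 0 y t ≤ 0 := by
  have h0 : |(0:ℝ)| < L := by simpa using hL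
  refine (u_jets hsol h0 hy ht).1.max ?_
  have : ∀ᶠ s in nhds (0:ℝ), |s| < L := continuous_abs.continuousAt.eventually (gt_mem_nhds h0)
  filter_upwards [this] with s hs
  exact mono_x hsol hmon hs hy ht

lemma m_unbdd (hp : 2 < p) (hL : 0 < L) (hT : 0 < T) (hsol : ClassicalSolution p L T u)
    (hgbu : IsolatedGBU L T u) (hmon : MonCond L T u) (M δ : ℝ) (hδ : 0 < δ) :
    ∃ t, T - δ < t ∧ T / 2 ≤ t ∧ t < T ∧ M < pdy u 0 0 t := by
  by_contra! hcon
  obtain ⟨G, hG0, hG⟩ := disc_bound hL hsol (a := T / 2) (b := T - δ) (by positivity) (by linarith)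
  obtain ⟨C, hC0, hC⟩ := all_bounds hp hL hT hsol hgbu
  have hM : ∀ t, T / 2 ≤ t → t < T → pdy u 0 0 t ≤ |M| + G := by
    intro t h1 h2
    rcases lt_or_ge (T - δ) t with h3 | h3
    · have := hcon t h3 h1 h2
      linarith [le_abs_self M]
    · have := hG 0 0 t (by nlinarith [sq_nonneg L]) le_rfl h1 h3
      have := pdy_le u 0 0 t
      linarith [abs_nonneg M, le_abs_self (pdy u 0 0 t)]
  obtain ⟨D, hD0, hD⟩ := uy_low hp hL hT hsol hgbu (|M| + G + 1) (-1) (by simp) (by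
    intro T' hT1 hT2
    have hm : 0 < L / 2 := by positivity
    filter_upwards [close_all hL hT hsol hT2, ev_small hm] with h h1 ⟨hpos, hle⟩ x t a1 a2 a3
    obtain ⟨-, q, -⟩ := h1 0 0 t ⟨by norm_num, by simp only; nlinarith [sq_nonneg L], le_rfl, a2, a3⟩
    have b0 : u 0 0 t = 0 := hsol.bc (by simpa using hL) ⟨by linarith, by linarith⟩
    simp only [mul_zero, mul_one, add_zero, zero_add, b0, sub_zero] at q
    have q1 := (abs_le.1 q).2
    have q2 := hM t a2 (by linarith)
    have q3 := mono_x hsol hmon (x := x) (y := h) (t := t) (dom_lt hL (x := x) (y := 0) (by nlinarith [sq_nonneg L])).1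
      ⟨hpos, by linarith⟩ ⟨by linarith, by linarith⟩
    have q4 : h⁻¹ * u x h t ≤ h⁻¹ * u 0 h t := mul_le_mul_of_nonneg_left q3 (by positivity)
    linarith)
  obtain ⟨x, y, t, -, b2, b3, b4, b5, b6, b7⟩ := hgbu.blowup (C + (C + D + |M| + G + 1)) (min (L / 8) (T / 2))
    (lt_min (by positivity) (by positivity))
  have c1 := abs_lt.1 (b4.trans_le (min_le_left _ _))
  have c2 := abs_lt.1 (b5.trans_le (min_le_left _ _))
  have c3 := min_le_right (L / 8) (T / 2)
  have hr : x ^ 2 + y ^ 2 ≤ (L / 4) ^ 2 := by nlinarith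
  obtain ⟨e1, e2, e3, e4⟩ := hC x y t ⟨hr, b2.1, by linarith, b3.2⟩
  have e5 := hD x y t hr b2.1 (by linarith) b3.2
  have e6 : |pdy u x y t| ≤ C + D + |M| + G + 1 := abs_le.2 ⟨by linarith [abs_nonneg M], by linarith [abs_nonneg M]⟩
  have e7 : gradNorm u x y t ≤ |pdx u x y t| + |pdy u x y t| := by
    apply Real.sqrt_le_iff.2
    refine ⟨by positivity, ?_⟩
    rw [← sq_abs (pdx u x y t), ← sq_abs (pdy u x y t)]
    nlinarith [mul_nonneg (abs_nonneg (pdx u x y t)) (abs_nonneg (pdy u x y t))]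
  linarith

lemma axis_low (hp : 2 < p) (hL : 0 < L) (hT : 0 < T) (hsol : ClassicalSolution p L T u)
    (hmon : MonCond L T u) {C N y0 t : ℝ} (hC0 : 0 ≤ C) (hN : 0 < N)
    (hC : ∀ x y t, Reg L T x y t → |pdt u x y t| ≤ C) (hy0 : 0 ≤ y0) (hyR : y0 ≤ L / 4)
    (hyA : (C + 1 + (2 * N) ^ p) * y0 ≤ N) (h1 : T / 2 ≤ t) (h2 : t < T) (hm : 2 * N < pdy u 0 0 t) :
    ∀ y ∈ Icc 0 y0, N ≤ pdy u 0 y t := by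
  set A := C + 1 + (2 * N) ^ p with hA
  have hpow : 0 ≤ (2 * N) ^ p := by positivity
  have hA0 : 0 < A := by linarith
  have hD : ∀ y ∈ Icc 0 y0, HasDerivAt (fun s => pdy u 0 s t) (pdyy u 0 y t) y := fun y hy =>
    (smT hL hT hsol (x := 0) (y := y) (by nlinarith [hy.1, hy.2]) hy.1 h1 h2).2.2.2.2.1.hasDerivAt
  have key := image_le_of_deriv_right_lt_deriv_boundary' (f := fun y => -pdy u 0 y t) (f' := fun y => -pdyy u 0 y t)
    (a := 0) (b := y0) (B := fun y => -(2 * N) + A * y) (B' := fun _ => A)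
    (fun y hy => ((hD y hy).neg).continuousAt.continuousWithinAt)
    (fun y hy => ((hD y ⟨hy.1, hy.2.le⟩).neg).hasDerivWithinAt)
    (by linarith) (by fun_prop)
    (fun y _ => by
      have := ((hasDerivAt_id y).const_mul A).const_add (-(2 * N))
      simp only [mul_one] at this
      exact this.hasDerivWithinAt)
    (fun y hy he => by
      have hy0 : 0 < y := by
        rcases hy.1.lt_or_eq with h | h
        · exact h
        · rw [← h] at he; linarith
      have hyL : y ∈ Ioo (0:ℝ) L := ⟨hy0, by linarith [hy.2]⟩
      have ht : t ∈ Ioo 0 T := ⟨by linarith, h2⟩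
      obtain ⟨x1, x2⟩ := axis hL hsol hmon hyL ht
      have pd := hsol.pde (x := 0) (by simpa using hL) hyL ht
      have hg : gradNorm u 0 y t = |pdy u 0 y t| := by
        rw [gradNorm, x1]; simp [Real.sqrt_sq_eq_abs]
      have hb : |pdy u 0 y t| ≤ 2 * N := by
        have : A * y ≤ A * y0 := mul_le_mul_of_nonneg_left hy.2.le hA0.le
        have : 0 ≤ A * y := by positivity
        exact abs_le.2 ⟨by linarith, by linarith⟩
      have hgp : gradNorm u 0 y t ^ p ≤ (2 * N) ^ p := by
        rw [hg]; exact Real.rpow_le_rpow (abs_nonneg _) hb (by linarith)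
      have := (abs_le.1 (hC 0 y t ⟨by nlinarith [hy.1, hy.2], hy0.le, h1, h2⟩)).1
      linarith)
  intro y hy
  have h3 := key hy
  have : A * y ≤ A * y0 := mul_le_mul_of_nonneg_left hy.2 hA0.le
  linarith

lemma final (hp : 2 < p) (hL : 0 < L) (hT : 0 < T) (hsol : ClassicalSolution p L T u)
    (hgbu : IsolatedGBU L T u) (hmon : MonCond L T u) (M : ℝ) (hM : 0 < M) :
    ∃ δ : ℝ, 0 < δ ∧ ∀ x y t : ℝ, y ∈ Ioo (0:ℝ) L → t ∈ Ioo 0 T →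
      |x| + |y| < δ → T - δ < t → M ≤ pdy u x y t := by
  obtain ⟨C, hC0, hC⟩ := all_bounds hp hL hT hsol hgbu
  set N := 2 * (M + 2 * C) with hN
  have hNp : 0 < N := by positivity
  set A := C + 1 + (2 * N) ^ p with hA
  have hpow : 0 ≤ (2 * N) ^ p := by positivity
  have hA0 : 0 < A := by linarith
  obtain ⟨y0, hy0, hy1⟩ : ∃ y0 : ℝ, 0 < y0 ∧ y0 ≤ min (min (N / A) 1) (L / 8) :=
    ⟨_, lt_min (lt_min (by positivity) one_pos) (by positivity), le_rfl⟩
  have i1 : y0 ≤ N / A := hy1.trans ((min_le_left _ _).trans (min_le_left _ _))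
  have i2 : y0 ≤ 1 := hy1.trans ((min_le_left _ _).trans (min_le_right _ _))
  have i3 : y0 ≤ L / 8 := hy1.trans (min_le_right _ _)
  have i4 : A * y0 ≤ N := by rw [le_div_iff₀ hA0] at i1; linarith
  obtain ⟨δ, hδ, hδ1⟩ : ∃ δ : ℝ, 0 < δ ∧ δ ≤ min (min (y0 / 2) (T / 2)) (N * y0 / (16 * (C + 1))) :=
    ⟨_, lt_min (lt_min (by positivity) (by positivity)) (by positivity), le_rfl⟩
  have j1 : δ ≤ y0 / 2 := hδ1.trans ((min_le_left _ _).trans (min_le_left _ _))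
  have j2 : δ ≤ T / 2 := hδ1.trans ((min_le_left _ _).trans (min_le_right _ _))
  have j3 : δ * (16 * (C + 1)) ≤ N * y0 := by
    have := hδ1.trans (min_le_right _ _)
    rwa [le_div_iff₀ (by positivity)] at this
  refine ⟨δ, hδ, fun x y t hy ht hxy htδ => ?_⟩
  obtain ⟨t1, s1, s2, s3, s4⟩ := m_unbdd hp hL hT hsol hgbu hmon (2 * N) δ hδ
  have hax := axis_low hp hL hT hsol hmon hC0 hNp (fun x y t h => (hC x y t h).2.1) hy0.le (by linarith) i4 s2 s3 s4
  have hx8 : |x| ≤ δ := by linarith [abs_nonneg y]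
  have hyδ : y < δ := by linarith [abs_nonneg x, le_abs_self y]
  have hreg : ∀ x' y' t', |x'| ≤ L / 8 → 0 ≤ y' → y' ≤ y0 → T / 2 ≤ t' → t' < T → Reg L T x' y' t' := by
    intro x' y' t' a1 a2 a3 a4 a5
    have := abs_le.1 a1
    exact ⟨by nlinarith, a2, a4, a5⟩
  have hsm : ∀ {x' y' t'}, Reg L T x' y' t' → C21At u x' y' t' := fun {x' y' t'} h =>
    smT hL hT hsol (by nlinarith [h.1, sq_nonneg L]) h.2.1 h.2.2.1 h.2.2.2
  have hyy : y < y0 := by linarith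
  have h00 : |(0:ℝ)| ≤ L / 8 := by simp; positivity
  have hxL : |x| ≤ L / 8 := by linarith
  have htT : T / 2 ≤ t := by linarith
  -- growth along the axis
  have g1 : N * (y0 - y) ≤ u 0 y0 t1 - u 0 y t1 := by
    refine Convex.mul_sub_le_image_sub_of_le_deriv (convex_Icc 0 y0) (f := fun s => u 0 s t1)
      (fun s hs => (hsm (hreg 0 s t1 h00 hs.1 hs.2 s2 s3)).2.1.continuousAt.continuousWithinAt)
      (fun s hs => ?_) (fun s hs => hax s (interior_subset hs)) y ⟨hy.1.le, hyy.le⟩ y0 ⟨hy0.le, le_rfl⟩ hyy.le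
    have hs' := interior_subset hs
    exact (hsm (hreg 0 s t1 h00 hs'.1 hs'.2 s2 s3)).2.1.differentiableWithinAt
  have lipt : ∀ y', 0 ≤ y' → y' ≤ y0 → |u 0 y' t - u 0 y' t1| ≤ C * δ := by
    intro y' a1 a2
    have := Convex.norm_image_sub_le_of_norm_deriv_le (f := fun s => u 0 y' s) (s := Ico (T / 2) T) (C := C)
      (x := t1) (y := t)
      (fun s hs => (hsm (hreg 0 y' s h00 a1 a2 hs.1 hs.2)).2.2.1)
      (fun s hs => (hC 0 y' s (hreg 0 y' s h00 a1 a2 hs.1 hs.2)).2.1) (convex_Ico _ _) ⟨s2, s3⟩ ⟨htT, ht.2⟩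
    refine this.trans (mul_le_mul_of_nonneg_left ?_ hC0)
    rw [Real.norm_eq_abs]
    exact abs_le.2 ⟨by linarith, by linarith [ht.2]⟩
  have lipx : ∀ y', 0 ≤ y' → y' ≤ y0 → |u x y' t - u 0 y' t| ≤ C * δ := by
    intro y' a1 a2
    have := Convex.norm_image_sub_le_of_norm_deriv_le (f := fun s => u s y' t) (s := Icc (-(L / 8)) (L / 8)) (C := C)
      (x := 0) (y := x)
      (fun s hs => (hsm (hreg s y' t (abs_le.2 hs) a1 a2 htT ht.2)).1)
      (fun s hs => (hC s y' t (hreg s y' t (abs_le.2 hs) a1 a2 htT ht.2)).1) (convex_Icc _ _) (abs_le.1 h00) (abs_le.1 hxL)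
    refine this.trans (mul_le_mul_of_nonneg_left ?_ hC0)
    rw [Real.norm_eq_abs, sub_zero]; exact hx8
  have k1 := abs_le.1 (lipt y0 hy0.le le_rfl)
  have k2 := abs_le.1 (lipt y hy.1.le hyy.le)
  have k3 := abs_le.1 (lipx y0 hy0.le le_rfl)
  have k4 := abs_le.1 (lipx y hy.1.le hyy.le)
  have g2 : N / 2 * (y0 - y) ≤ u x y0 t - u x y t := by nlinarith
  -- mean value
  have hR : ∀ s ∈ Icc y y0, Reg L T x s t := fun s hs => hreg x s t hxL (by linarith [hs.1, hy.1]) hs.2 htT ht.2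
  obtain ⟨ξ, hξ, e1⟩ := exists_hasDerivAt_eq_slope (fun s => u x s t) (fun s => pdy u x s t) hyy
    (fun s hs => (hsm (hR s hs)).2.1.continuousAt.continuousWithinAt)
    (fun s hs => (hsm (hR s ⟨hs.1.le, hs.2.le⟩)).2.1.hasDerivAt)
  have e1' : N / 2 ≤ pdy u x ξ t := by
    rw [e1, le_div_iff₀ (by linarith)]; exact g2
  have hR2 : ∀ s ∈ Icc y ξ, Reg L T x s t := fun s hs => hR s ⟨hs.1, by linarith [hs.2, hξ.2]⟩
  obtain ⟨η, hη, e2⟩ := exists_hasDerivAt_eq_slope (fun s => pdy u x s t) (fun s => pdyy u x s t) hξ.1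
    (fun s hs => (hsm (hR2 s hs)).2.2.2.2.1.continuousAt.continuousWithinAt)
    (fun s hs => (hsm (hR2 s ⟨hs.1.le, hs.2.le⟩)).2.2.2.2.1.hasDerivAt)
  have e3 : pdyy u x η t ≤ 2 * C := by
    have hηR := hR2 η ⟨hη.1.le, hη.2.le⟩
    obtain ⟨b1, b2, b3, b4⟩ := hC x η t hηR
    have pd := hsol.pde (x := x) (y := η) (t := t) (by linarith) ⟨by linarith [hη.1, hy.1], by linarith [hη.2, hξ.2]⟩ ht
    have := Real.rpow_nonneg (grad_nonneg u x η t) p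
    linarith [(abs_le.1 b2).2]
  have hpos : 0 < ξ - y := by linarith [hξ.1]
  rw [e2, div_le_iff₀ hpos] at e3
  have : 2 * C * (ξ - y) ≤ 2 * C * 1 := mul_le_mul_of_nonneg_left (by linarith [hξ.2, hy.1]) (by positivity)
  linarith
end main8

/-- Proposition 2.3: pointwise blow-up, `u_y(x,y,t) → +∞` as `(x,y) → (0,0)`
and `t → T⁻`. -/
theorem uy_tendsto_infty (p L T : ℝ) (hp : 2 < p) (hL : 0 < L) (hT : 0 < T)
    (u : ℝ → ℝ → ℝ → ℝ)
    (hsol : ClassicalSolution p L T u) (hgbu : IsolatedGBU L T u)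
    (hmon : MonCond L T u) :
    ∀ M : ℝ, 0 < M → ∃ δ : ℝ, 0 < δ ∧ ∀ x y t : ℝ,
      |x| < L → y ∈ Ioo (0:ℝ) L → t ∈ Ioo 0 T →
      |x| + |y| < δ → T - δ < t → M ≤ pdy u x y t := by
  intro M hM
  obtain ⟨δ, hδ, h⟩ := final hp hL hT hsol hgbu hmon M hM
  exact ⟨δ, hδ, fun x y t _ hy ht hxy htδ => h x y t hy ht hxy htδ⟩
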